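/- Strict unimodality with mode asymptotics: for each r > 0 there exists a_r > 0 such that t ↦ p̄(r,t) is strictly increasing on [0, a_r) and strictly decreasing on (a_r, ∞); moreover there is a constant c ≥ 1 such that c^{-1}/φ^{-1}(1/r) ≤ a_r ≤ c/φ^{-1}(1/r) for all r > 0. -/

import Mathlib

open MeasureTheory Filter Set
open scoped ENNReal Topology FourierTransform Convolution

lemma integral_mul_nonneg_of_monotoneOn {P q g : ℝ → ℝ} {b : ℝ}
    (hP : ∀ x, HasDerivAt P (q x) x) (hq : Continuous q) (hgm : Measurable g)
    (hg : MonotoneOn g (Ioo 0 b)) (hg0 : ∀ u ∈ Ioo 0 b, 0 ≤ g u)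
    (hgi : IntegrableOn g (Ioo 0 b)) (hmax : ∀ u ∈ Icc 0 b, P u ≤ P b) :
    0 ≤ ∫ u in Ioo 0 b, q u * g u := by
  have hqi : IntegrableOn (fun u => q u * g u) (Ioo 0 b) := by
    have h1 : IntegrableOn g (Icc 0 b) := by rwa [integrableOn_Icc_iff_integrableOn_Ioo]
    exact (h1.continuousOn_mul hq.continuousOn isCompact_Icc).mono_set Ioo_subset_Icc_self
  let f : ℝ → ℝ → ℝ := fun u t => q u * (Iio (g u)).indicator (fun _ => (1:ℝ)) t
  have hlayer : ∀ u ∈ Ioo 0 b,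
      ∫ t in Ioi (0:ℝ), (Iio (g u)).indicator (fun _ => (1:ℝ)) t = g u := by
    intro u hu
    rw [integral_indicator measurableSet_Iio, Measure.restrict_restrict measurableSet_Iio,
      Iio_inter_Ioi]
    simp [hg0 u hu]
  have hfm : Measurable (Function.uncurry f) := by
    have hs : MeasurableSet {z : ℝ × ℝ | z.2 < g z.1} :=
      measurableSet_lt measurable_snd (hgm.comp measurable_fst)
    have : Function.uncurry f =
        fun z => q z.1 * {z : ℝ × ℝ | z.2 < g z.1}.indicator (fun _ => (1:ℝ)) z := by
      ext z
      simp [Function.uncurry, f, indicator]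
    rw [this]
    exact (hq.measurable.comp measurable_fst).mul (measurable_const.indicator hs)
  have hind : ∀ u, IntegrableOn ((Iio (g u)).indicator (fun _ => (1:ℝ))) (Ioi (0:ℝ)) := by
    intro u
    rw [IntegrableOn, integrable_indicator_iff measurableSet_Iio, IntegrableOn,
      Measure.restrict_restrict measurableSet_Iio, Iio_inter_Ioi]
    exact integrable_const _
  have hfi : Integrable (Function.uncurry f)
      ((volume.restrict (Ioo 0 b)).prod (volume.restrict (Ioi (0:ℝ)))) := by
    rw [integrable_prod_iff hfm.aestronglyMeasurable]
    refine ⟨Eventually.of_forall fun u => Integrable.const_mul (hind u) (q u), ?_⟩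
    refine hqi.norm.congr ?_
    filter_upwards [ae_restrict_mem measurableSet_Ioo] with u hu
    have : ∀ t, ‖Function.uncurry f (u, t)‖ = ‖q u‖ * (Iio (g u)).indicator (fun _ => (1:ℝ)) t := by
      intro t
      simp only [Function.uncurry, f, norm_mul]
      congr 1
      by_cases h : t ∈ Iio (g u) <;> simp [h]
    simp_rw [this]
    rw [integral_const_mul, hlayer u hu, norm_mul, Real.norm_of_nonneg (hg0 u hu)]
  have hrepr : ∫ u in Ioo 0 b, q u * g u = ∫ u in Ioo 0 b, ∫ t in Ioi (0:ℝ), f u t := by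
    refine setIntegral_congr_fun measurableSet_Ioo fun u hu => ?_
    simp only [f]
    rw [integral_const_mul, hlayer u hu]
  rw [hrepr, integral_integral_swap hfi]
  refine integral_nonneg fun t => ?_
  simp only [Pi.zero_apply, f]
  set S := {u | u ∈ Ioo 0 b ∧ t < g u} with hS
  have hSm : MeasurableSet S := measurableSet_Ioo.inter (measurableSet_lt measurable_const hgm)
  have hint : ∫ u in Ioo 0 b, q u * (Iio (g u)).indicator (fun _ => (1:ℝ)) t = ∫ u in S, q u := by
    rw [← integral_indicator measurableSet_Ioo, ← integral_indicator hSm]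
    congr 1
    ext u
    by_cases h1 : u ∈ Ioo 0 b <;> by_cases h2 : t < g u <;>
      simp only [indicator, hS, mem_ofPred_eq, mem_Iio, h1, h2, and_true, and_false, if_true, if_false,
        mul_one, mul_zero]
  rw [hint]
  rcases S.eq_empty_or_nonempty with h | hne
  · simp [h]
  have hbdd : BddBelow S := ⟨0, fun u hu => hu.1.1.le⟩
  obtain ⟨u₀, hu₀⟩ := hne
  have hs0 : 0 ≤ sInf S := le_csInf ⟨u₀, hu₀⟩ fun u hu => hu.1.1.le
  have hsb : sInf S < b := (csInf_le hbdd hu₀).trans_lt hu₀.1.2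
  have hsub1 : Ioo (sInf S) b ⊆ S := by
    intro u hu
    obtain ⟨v, hv, hvu⟩ := exists_lt_of_csInf_lt ⟨u₀, hu₀⟩ hu.1
    have hu' : u ∈ Ioo 0 b := ⟨hs0.trans_lt hu.1, hu.2⟩
    exact ⟨hu', hv.2.trans_le (hg hv.1 hu' hvu.le)⟩
  have hsub2 : S ⊆ Icc (sInf S) b := fun u hu => ⟨csInf_le hbdd hu, hu.1.2.le⟩
  have hae : S =ᵐ[volume] Ioc (sInf S) b := by
    refine hsub2.eventuallyLE.trans Ioc_ae_eq_Icc.symm.le |>.antisymm ?_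
    exact Ioo_ae_eq_Ioc.symm.le.trans hsub1.eventuallyLE
  rw [setIntegral_congr_set hae, ← intervalIntegral.integral_of_le hsb.le,
    intervalIntegral.integral_eq_sub_of_hasDerivAt (fun x _ => hP x) (hq.intervalIntegrable _ _)]
  linarith [hmax _ ⟨hs0, hsb.le⟩]

lemma exists_first_zero {f : ℝ → ℝ} (hf : Continuous f) {c d : ℝ} (hcd : c < d)
    (hpos : ∀ x ∈ Ioc c d, 0 < f x) (hex : ∃ y, c < y ∧ f y ≤ 0) :
    ∃ a, d < a ∧ f a = 0 ∧ ∀ x ∈ Ioo c a, 0 < f x := by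
  obtain ⟨y, hcy, hy⟩ := hex
  have hdy : d < y := by
    by_contra h
    exact (hpos y ⟨hcy, not_lt.mp h⟩).not_ge hy
  have hS : IsCompact (Icc d y ∩ {x | f x ≤ 0}) :=
    isCompact_Icc.inter_right (isClosed_le hf continuous_const)
  obtain ⟨a, ⟨haI, hfa⟩, hmin⟩ := hS.exists_isLeast ⟨y, ⟨hdy.le, le_rfl⟩, hy⟩
  have hfd := hpos d ⟨hcd, le_rfl⟩
  obtain ⟨z, hz, hfz⟩ := intermediate_value_Icc' haI.1 hf.continuousOn ⟨hfa, hfd.le⟩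
  have hza : z = a := le_antisymm hz.2 (hmin ⟨⟨hz.1, hz.2.trans haI.2⟩, hfz.le⟩)
  subst hza
  refine ⟨z, lt_of_le_of_ne haI.1 fun h => ?_, hfz, fun x hx => ?_⟩
  · rw [h, hfz] at hfd
    exact hfd.false
  · by_contra hx0
    have hdx : d < x := by
      by_contra h
      exact hx0 (hpos x ⟨hx.1, not_lt.mp h⟩)
    exact (hmin ⟨⟨hdx.le, hx.2.le.trans haI.2⟩, not_lt.mp hx0⟩).not_gt hx.2

lemma intervalIntegral_pos_of_nonneg_of_pos_right {f : ℝ → ℝ} {s m t : ℝ} (hsm : s ≤ m)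
    (hmt : m < t) (hf : IntervalIntegrable f volume s t) (h0 : ∀ x ∈ Ioo s t, 0 ≤ f x)
    (hpos : ∀ x ∈ Ioo m t, 0 < f x) : 0 < ∫ x in s..t, f x := by
  have h1 : IntervalIntegrable f volume s m :=
    hf.mono_set (by rw [uIcc_of_le hsm, uIcc_of_le (hsm.trans hmt.le)]; exact Icc_subset_Icc_right hmt.le)
  have h2 : IntervalIntegrable f volume m t :=
    hf.mono_set (by rw [uIcc_of_le hmt.le, uIcc_of_le (hsm.trans hmt.le)]; exact Icc_subset_Icc_left hsm)
  rw [← intervalIntegral.integral_add_adjacent_intervals h1 h2]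
  have h3 : 0 ≤ ∫ x in s..m, f x := by
    rw [intervalIntegral.integral_of_le hsm, integral_Ioc_eq_integral_Ioo]
    exact setIntegral_nonneg measurableSet_Ioo fun x hx => h0 x ⟨hx.1, hx.2.trans hmt⟩
  linarith [intervalIntegral.intervalIntegral_pos_of_pos_on h2 hpos hmt]

lemma intervalIntegrable_mul_comp_sub {k q : ℝ → ℝ} (hq : Continuous q) {x s t : ℝ}
    (hk : IntervalIntegrable k volume 0 x) (hs : 0 ≤ s) (hst : s ≤ t) (htx : t ≤ x) :
    IntervalIntegrable (fun u => q u * k (x - u)) volume s t := by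
  have h := hk.comp_sub_left x
  simp only [sub_zero, sub_self] at h
  have h' := (h.continuousOn_mul (g := q) hq.continuousOn).symm
  refine h'.mono_set ?_
  rw [uIcc_of_le hst, uIcc_of_le (hs.trans (hst.trans htx))]
  exact Icc_subset_Icc hs htx

lemma exists_kernel_gt {k : ℝ → ℝ} (hk : AntitoneOn k (Ioi 0)) (hk0 : ∀ N, ∃ x, 0 < x ∧ N < k x)
    (N : ℝ) {ε : ℝ} (hε : 0 < ε) : ∃ y, 0 < y ∧ y < ε ∧ ∀ x ∈ Ioc 0 y, N < k x := by
  obtain ⟨x, hx, hkx⟩ := hk0 N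
  refine ⟨min x (ε / 2), lt_min hx (by linarith), (min_le_right _ _).trans_lt (by linarith), ?_⟩
  intro y hy
  exact hkx.trans_le (hk hy.1 hx (hy.2.trans (min_le_left _ _)))

section Core

variable {k P q : ℝ → ℝ}

lemma deriv_pos_of_one_lt_kernel (hk : AntitoneOn k (Ioi 0)) (hkm : Measurable k)
    (hkI : ∀ T, 0 < T → IntervalIntegrable k volume 0 T)
    (hP : ∀ x, HasDerivAt P (q x) x) (hq : Continuous q) (hP0 : P 0 = 0)
    (hPpos : ∀ ε, 0 < ε → ∃ x ∈ Ioo 0 ε, 0 < P x)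
    (hE : ∀ x, 0 < x → x * q x + P x = ∫ u in 0..x, q u * k (x - u))
    {x : ℝ} (hx : 0 < x) (hkx : 1 < k x) : 0 < q x := by
  have hPc : Continuous P := continuous_iff_continuousAt.2 fun x => (hP x).continuousAt
  obtain ⟨b, hbI, hbmax⟩ := isCompact_Icc.exists_isMaxOn (nonempty_Icc.2 hx.le) hPc.continuousOn
  obtain ⟨y, hy, hPy⟩ := hPpos x hx
  have hPb : 0 < P b := hPy.trans_le (hbmax ⟨hy.1.le, hy.2.le⟩)
  have hb0 : 0 < b := by
    rcases hbI.1.eq_or_lt with h | h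
    · rw [← h, hP0] at hPb
      exact absurd hPb (lt_irrefl _)
    · exact h
  have hkb : 1 < k b := hkx.trans_le (hk hb0 hx hbI.2)
  have hki := intervalIntegrable_mul_comp_sub hq (hkI b hb0) le_rfl hb0.le le_rfl
  have hqi : IntervalIntegrable (fun u => q u * k b) volume 0 b :=
    (hq.mul continuous_const).intervalIntegrable _ _
  have hint : ∫ u in 0..b, q u = P b := by
    rw [intervalIntegral.integral_eq_sub_of_hasDerivAt (fun x _ => hP x)
      (hq.intervalIntegrable _ _), hP0, sub_zero]
  have hnn : 0 ≤ ∫ u in Ioo 0 b, q u * (k (b - u) - k b) := by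
    refine integral_mul_nonneg_of_monotoneOn (P := P) hP hq ?_ ?_ ?_ ?_ ?_
    · exact (hkm.comp (measurable_const.sub measurable_id)).sub_const _
    · intro u hu v hv huv
      have : k (b - u) ≤ k (b - v) :=
        hk (sub_pos.2 hv.2) (sub_pos.2 hu.2) (sub_le_sub_left huv b)
      simpa using this
    · intro u hu
      exact sub_nonneg.2 (hk (sub_pos.2 hu.2) hb0 (by linarith [hu.1]))
    · have h := ((hkI b hb0).comp_sub_left b).symm
      simp only [sub_zero, sub_self] at h
      rw [intervalIntegrable_iff_integrableOn_Ioo_of_le hb0.le] at h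
      exact Integrable.sub h (integrable_const (k b))
    · intro u hu
      exact hbmax ⟨hu.1, hu.2.trans hbI.2⟩
  rw [← integral_Ioc_eq_integral_Ioo, ← intervalIntegral.integral_of_le hb0.le] at hnn
  simp_rw [mul_sub] at hnn
  rw [intervalIntegral.integral_sub hki hqi, intervalIntegral.integral_mul_const, hint,
    ← hE b hb0] at hnn
  have hqb : 0 < q b := by
    have : 0 < b * q b := by nlinarith
    exact (mul_pos_iff_of_pos_left hb0).1 this
  rcases hbI.2.eq_or_lt with h | h
  · rwa [← h]
  · have hloc : IsLocalMax P b := hbmax.isLocalMax (Icc_mem_nhds hb0 h)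
    rw [hloc.hasDerivAt_eq_zero (hP b)] at hqb
    exact absurd hqb (lt_irrefl _)

lemma mul_deriv_lt_integral_of_first_zero (hk : AntitoneOn k (Ioi 0))
    (hkI : ∀ T, 0 < T → IntervalIntegrable k volume 0 T) (hk0 : ∀ N, ∃ x, 0 < x ∧ N < k x)
    (hP : ∀ x, HasDerivAt P (q x) x) (hq : Continuous q)
    (hE : ∀ x, 0 < x → x * q x + P x = ∫ u in 0..x, q u * k (x - u))
    {a b : ℝ} (ha : 0 < a) (hqa : q a = 0) (hqpos : ∀ x ∈ Ioo 0 a, 0 < q x) (hab : a < b) :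
    b * q b < ∫ u in a..b, q u * (k (b - u) - 1) := by
  have hb : 0 < b := ha.trans hab
  have hia := intervalIntegrable_mul_comp_sub hq (hkI a ha) le_rfl ha.le le_rfl
  have hib1 := intervalIntegrable_mul_comp_sub hq (hkI b hb) le_rfl ha.le hab.le
  have hib2 := intervalIntegrable_mul_comp_sub hq (hkI b hb) ha.le hab.le le_rfl
  obtain ⟨y, hy0, hya, hyk⟩ := exists_kernel_gt hk hk0 (k (b - a)) ha
  have hpos : 0 < ∫ u in 0..a, (q u * k (a - u) - q u * k (b - u)) := by
    refine intervalIntegral_pos_of_nonneg_of_pos_right (m := a - y) (by linarith) (by linarith)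
      (hia.sub hib1) ?_ ?_
    · intro u hu
      have : k (b - u) ≤ k (a - u) :=
        hk (sub_pos.2 hu.2) (sub_pos.2 (hu.2.trans hab)) (by linarith)
      nlinarith [hqpos u hu]
    · intro u hu
      have hu' : u ∈ Ioo 0 a := ⟨by linarith [hu.1], hu.2⟩
      have h1 : k (b - u) ≤ k (b - a) :=
        hk (sub_pos.2 hab) (sub_pos.2 (hu.2.trans hab)) (by linarith [hu.2])
      have h2 := hyk (a - u) ⟨sub_pos.2 hu.2, by linarith [hu.1]⟩
      nlinarith [hqpos u hu']
  rw [intervalIntegral.integral_sub hia hib1, ← hE a ha, hqa, mul_zero, zero_add] at hpos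
  have hEb := hE b hb
  rw [← intervalIntegral.integral_add_adjacent_intervals hib1 hib2] at hEb
  simp_rw [mul_sub, mul_one]
  rw [intervalIntegral.integral_sub hib2 (hq.intervalIntegrable _ _),
    intervalIntegral.integral_eq_sub_of_hasDerivAt (fun x _ => hP x) (hq.intervalIntegrable _ _)]
  linarith

lemma deriv_neg_right_of_first_zero (hk : AntitoneOn k (Ioi 0))
    (hkI : ∀ T, 0 < T → IntervalIntegrable k volume 0 T) (hk0 : ∀ N, ∃ x, 0 < x ∧ N < k x)
    (hP : ∀ x, HasDerivAt P (q x) x) (hq : Continuous q)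
    (hE : ∀ x, 0 < x → x * q x + P x = ∫ u in 0..x, q u * k (x - u))
    {a : ℝ} (ha : 0 < a) (hqa : q a = 0) (hqpos : ∀ x ∈ Ioo 0 a, 0 < q x) :
    ∃ d, a < d ∧ ∀ x ∈ Ioc a d, q x < 0 := by
  obtain ⟨y, hy0, -, hyk⟩ := exists_kernel_gt hk hk0 1 one_pos
  have hprim : ∃ h, 0 < h ∧ h ≤ y ∧ ∫ u in 0..h, (k u - 1) < a := by
    have hc : ContinuousOn (fun x => ∫ u in 0..x, (k u - 1)) (uIcc 0 y) := by
      apply intervalIntegral.continuousOn_primitive_interval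
      rw [uIcc_of_le hy0.le, integrableOn_Icc_iff_integrableOn_Ioc,
        ← intervalIntegrable_iff_integrableOn_Ioc_of_le hy0.le]
      exact (hkI y hy0).sub intervalIntegrable_const
    rw [uIcc_of_le hy0.le] at hc
    have h0 := (hc 0 ⟨le_rfl, hy0.le⟩).mono_left
      (nhdsWithin_mono _ (Ioc_subset_Icc_self : Ioc 0 y ⊆ Icc 0 y))
    simp only [intervalIntegral.integral_same] at h0
    rw [nhdsWithin_Ioc_eq_nhdsGT hy0] at h0
    obtain ⟨h, hh1, hh2⟩ := ((h0.eventually_lt_const ha).and (Ioc_mem_nhdsGT hy0)).exists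
    exact ⟨h, hh2.1, hh2.2, hh1⟩
  obtain ⟨h, hh0, hhy, hh⟩ := hprim
  have hk1 : ∀ x ∈ Ioc 0 h, 1 < k x := fun x hx => hyk x ⟨hx.1, hx.2.trans hhy⟩
  have hlt := fun b hab => mul_deriv_lt_integral_of_first_zero (b := b) hk hkI hk0 hP hq hE ha hqa
    hqpos hab
  have hle : ∀ x ∈ Icc a (a + h), q x ≤ 0 := by
    obtain ⟨m, hmI, hm⟩ := isCompact_Icc.exists_isMaxOn
      (nonempty_Icc.2 (by linarith : a ≤ a + h)) hq.continuousOn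
    intro x hx
    refine (hm hx).trans (not_lt.1 fun hqm => ?_)
    have ham : a < m := lt_of_le_of_ne hmI.1 fun hne => by
      rw [← hne, hqa] at hqm; exact lt_irrefl _ hqm
    have hm0 := ha.trans ham
    have hi : IntervalIntegrable (fun u => k (m - u) - 1) volume a m := by
      have := intervalIntegrable_mul_comp_sub (q := fun _ => 1) continuous_const (hkI m hm0) ha.le
        ham.le le_rfl
      simp only [one_mul] at this
      exact this.sub intervalIntegrable_const
    have hi' : IntervalIntegrable (fun u => q u * (k (m - u) - 1)) volume a m :=
      hi.continuousOn_mul hq.continuousOn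
    have h1 : ∫ u in a..m, q u * (k (m - u) - 1) ≤ ∫ u in a..m, q m * (k (m - u) - 1) := by
      refine intervalIntegral.integral_mono_on_of_le_Ioo ham.le hi' (hi.const_mul _) fun u hu => ?_
      have hqu : q u ≤ q m := hm ⟨hu.1.le, hu.2.le.trans hmI.2⟩
      have := hk1 (m - u) ⟨sub_pos.2 hu.2, by linarith [hu.1, hmI.2]⟩
      nlinarith
    have h2 : ∫ u in a..m, (k (m - u) - 1) = ∫ u in 0..(m - a), (k u - 1) := by
      rw [intervalIntegral.integral_comp_sub_left (fun u => k u - 1) m, sub_self]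
    have hma : m - a ≤ h := by linarith [hmI.2]
    have h3 : ∫ u in 0..(m - a), (k u - 1) ≤ ∫ u in 0..h, (k u - 1) := by
      refine intervalIntegral.integral_mono_interval le_rfl (sub_pos.2 ham).le hma ?_
        ((hkI h hh0).sub intervalIntegrable_const)
      filter_upwards [ae_restrict_mem measurableSet_Ioc] with u hu
      exact sub_nonneg.2 (hk1 u hu).le
    rw [intervalIntegral.integral_const_mul, h2] at h1
    have := hlt m ham
    nlinarith
  refine ⟨a + h, by linarith, fun x hx => ?_⟩
  have hx0 : 0 < x := ha.trans hx.1
  have h1 : ∫ u in a..x, q u * (k (x - u) - 1) ≤ 0 := by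
    rw [intervalIntegral.integral_of_le hx.1.le, integral_Ioc_eq_integral_Ioo]
    refine setIntegral_nonpos measurableSet_Ioo fun u hu => ?_
    have := hk1 (x - u) ⟨sub_pos.2 hu.2, by linarith [hu.1, hx.2]⟩
    have := hle u ⟨hu.1.le, hu.2.le.trans hx.2⟩
    nlinarith
  have := (hlt x hx.1).trans_le h1
  by_contra! hqx
  exact this.not_ge (mul_nonneg hx0.le hqx)

theorem exists_mode_of_kernel_equation (hk : AntitoneOn k (Ioi 0)) (hkm : Measurable k)
    (hkI : ∀ T, 0 < T → IntervalIntegrable k volume 0 T) (hk0 : ∀ N, ∃ x, 0 < x ∧ N < k x)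
    (hP : ∀ x, HasDerivAt P (q x) x) (hq : Continuous q) (hP0 : P 0 = 0) (hPnn : ∀ x, 0 ≤ P x)
    (hPpos : ∀ ε, 0 < ε → ∃ x ∈ Ioo 0 ε, 0 < P x)
    (hPmono : ¬ StrictMonoOn P (Ici 0))
    (hE : ∀ x, 0 < x → x * q x + P x = ∫ u in 0..x, q u * k (x - u)) :
    ∃ a, 0 < a ∧ StrictMonoOn P (Icc 0 a) ∧ StrictAntiOn P (Ici a) ∧
      ∀ x, 0 < x → 1 < k x → x ≤ a := by
  have hPc : Continuous P := continuous_iff_continuousAt.2 fun x => (hP x).continuousAt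
  have hnear : ∀ x, 0 < x → 1 < k x → 0 < q x := fun x hx hkx =>
    deriv_pos_of_one_lt_kernel hk hkm hkI hP hq hP0 hPpos hE hx hkx
  obtain ⟨y, hy0, -, hyk⟩ := exists_kernel_gt hk hk0 1 one_pos
  have hex : ∃ z, 0 < z ∧ q z ≤ 0 := by
    by_contra! h
    refine hPmono (strictMonoOn_of_deriv_pos (convex_Ici 0) hPc.continuousOn fun x hx => ?_)
    rw [interior_Ici] at hx
    rw [(hP x).deriv]
    exact h x hx
  obtain ⟨a, hya, hqa, hqpos⟩ := exists_first_zero hq hy0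
    (fun x hx => hnear x hx.1 (hyk x hx)) hex
  have ha : 0 < a := hy0.trans hya
  obtain ⟨d, had, hqd⟩ := deriv_neg_right_of_first_zero hk hkI hk0 hP hq hE ha hqa hqpos
  have hneg : ∀ x, a < x → q x < 0 := by
    by_contra! hcon
    obtain ⟨b, hdb, hqb, hqneg⟩ := exists_first_zero (f := fun x => -q x) hq.neg had
      (fun x hx => neg_pos.2 (hqd x hx)) (hcon.imp fun x hx => ⟨hx.1, neg_nonpos.2 hx.2⟩)
    simp only [neg_eq_zero, Left.neg_pos_iff] at hqb hqneg
    have hab : a < b := had.trans hdb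
    have hb := ha.trans hab
    have hib := intervalIntegrable_mul_comp_sub hq (hkI b hb) le_rfl hb.le le_rfl
    have hiq : IntervalIntegrable (fun u => q u * k (b - a)) volume 0 b :=
      (hq.mul continuous_const).intervalIntegrable _ _
    obtain ⟨z, hz0, hzb, hzk⟩ := exists_kernel_gt hk hk0 (k (b - a)) (sub_pos.2 hab)
    have hpos : 0 < ∫ u in 0..b, (q u * k (b - a) - q u * k (b - u)) := by
      refine intervalIntegral_pos_of_nonneg_of_pos_right (m := b - z) (by linarith) (by linarith)
        (hiq.sub hib) ?_ ?_
      · intro u hu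
        rcases lt_trichotomy u a with h | h | h
        · have := hqpos u ⟨hu.1, h⟩
          have : k (b - u) ≤ k (b - a) := hk (sub_pos.2 hab) (sub_pos.2 hu.2) (by linarith)
          nlinarith
        · simp [h, hqa]
        · have := hqneg u ⟨h, hu.2⟩
          have : k (b - a) ≤ k (b - u) := hk (sub_pos.2 hu.2) (sub_pos.2 hab) (by linarith)
          nlinarith
      · intro u hu
        have := hqneg u ⟨by linarith [hu.1], hu.2⟩
        have := hzk (b - u) ⟨sub_pos.2 hu.2, by linarith [hu.1]⟩
        nlinarith
    rw [intervalIntegral.integral_sub hiq hib,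
      intervalIntegral.integral_mul_const, ← hE b hb, hqb,
      intervalIntegral.integral_eq_sub_of_hasDerivAt (fun x _ => hP x)
        (hq.intervalIntegrable _ _), hP0] at hpos
    have hkab : 1 < k (b - a) := by
      have := hPnn b
      by_contra! hle
      nlinarith
    have hlt := mul_deriv_lt_integral_of_first_zero hk hkI hk0 hP hq hE ha hqa hqpos hab
    have h1 : ∫ u in a..b, q u * (k (b - u) - 1) ≤ 0 := by
      rw [intervalIntegral.integral_of_le hab.le, integral_Ioc_eq_integral_Ioo]
      refine setIntegral_nonpos measurableSet_Ioo fun u hu => ?_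
      have : k (b - a) ≤ k (b - u) :=
        hk (sub_pos.2 hu.2) (sub_pos.2 hab) (by linarith [hu.1])
      have := hqneg u hu
      nlinarith
    rw [hqb, mul_zero] at hlt
    exact hlt.not_ge h1
  refine ⟨a, ha, ?_, ?_, ?_⟩
  · refine strictMonoOn_of_deriv_pos (convex_Icc 0 a) hPc.continuousOn fun x hx => ?_
    rw [interior_Icc] at hx
    rw [(hP x).deriv]
    exact hqpos x hx
  · refine strictAntiOn_of_deriv_neg (convex_Ici a) hPc.continuousOn fun x hx => ?_
    rw [interior_Ici] at hx
    rw [(hP x).deriv]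
    exact hneg x hx
  · intro x hx hkx
    by_contra! hax
    exact (hnear x hx hkx).not_gt (hneg x hax)

end Core

/-- The complex Laplace transform of a density on the half-line. -/
noncomputable def halfLineLaplace (w : ℝ → ℝ) (z : ℂ) : ℂ :=
  ∫ x in Ioi (0:ℝ), Complex.exp (-z * x) * w x

lemma integrableOn_exp_mul_id_mul {w : ℝ → ℝ} (hwm : Measurable w)
    (hw : ∀ l : ℝ, 0 < l → IntegrableOn (fun x => Real.exp (-l * x) * w x) (Ioi 0))
    {l : ℝ} (hl : 0 < l) :
    IntegrableOn (fun x => Real.exp (-l * x) * (x * w x)) (Ioi 0) := by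
  refine ((hw (l / 2) (by positivity)).norm.const_mul (2 / l)).mono' (by fun_prop) ?_
  filter_upwards [ae_restrict_mem measurableSet_Ioi] with x hx
  have hx : 0 < x := hx
  have h1 : l * x / 2 ≤ Real.exp (l * x / 2) := by linarith [Real.add_one_le_exp (l * x / 2)]
  have h2 : Real.exp (-(l / 2) * x) = Real.exp (l * x / 2) * Real.exp (-l * x) := by
    rw [← Real.exp_add]; ring_nf
  have h3 : x ≤ 2 / l * Real.exp (l * x / 2) := by
    rw [div_mul_eq_mul_div, le_div_iff₀ hl]; linarith
  simp only [norm_mul, Real.norm_eq_abs, Real.abs_exp, abs_of_pos hx, h2]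
  have : 0 ≤ Real.exp (-l * x) * |w x| := by positivity
  nlinarith

lemma norm_cexp_neg_mul (z : ℂ) (x : ℝ) : ‖Complex.exp (-z * x)‖ = Real.exp (-z.re * x) := by
  simp [Complex.norm_exp]

lemma integrableOn_cexp_mul {w : ℝ → ℝ} (hwm : Measurable w)
    (hw : ∀ l : ℝ, 0 < l → IntegrableOn (fun x => Real.exp (-l * x) * w x) (Ioi 0))
    {z : ℂ} (hz : 0 < z.re) :
    IntegrableOn (fun x : ℝ => Complex.exp (-z * x) * w x) (Ioi 0) := by
  refine (hw z.re hz).norm.mono' (by fun_prop) (Eventually.of_forall fun x => ?_)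
  rw [norm_mul, norm_cexp_neg_mul, norm_mul, Real.norm_of_nonneg (Real.exp_pos _).le,
    Complex.norm_real]

lemma hasDerivAt_halfLineLaplace {w : ℝ → ℝ} (hwm : Measurable w)
    (hw : ∀ l : ℝ, 0 < l → IntegrableOn (fun x => Real.exp (-l * x) * w x) (Ioi 0))
    {z : ℂ} (hz : 0 < z.re) :
    HasDerivAt (halfLineLaplace w) (-halfLineLaplace (fun x => x * w x) z) z := by
  have hs : {ζ : ℂ | z.re / 2 < ζ.re} ∈ 𝓝 z :=
    (isOpen_lt continuous_const Complex.continuous_re).mem_nhds (by simp; linarith)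
  have h := (hasDerivAt_integral_of_dominated_loc_of_deriv_le
    (μ := volume.restrict (Ioi (0:ℝ)))
    (F := fun (ζ : ℂ) (x : ℝ) => Complex.exp (-ζ * x) * w x)
    (F' := fun (ζ : ℂ) (x : ℝ) => -(Complex.exp (-ζ * x) * (x * w x : ℝ)))
    (bound := fun x => ‖Real.exp (-(z.re / 2) * x) * (x * w x)‖) hs
    (Eventually.of_forall fun ζ => by fun_prop) (integrableOn_cexp_mul hwm hw hz) (by fun_prop)
    ?_ (integrableOn_exp_mul_id_mul hwm hw (by positivity)).norm ?_).2
  · convert! h using 1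
    rw [halfLineLaplace, integral_neg]
  · filter_upwards [ae_restrict_mem measurableSet_Ioi] with x hx ζ hζ
    have hx : 0 < x := hx
    have hζ : z.re / 2 < ζ.re := hζ
    rw [norm_neg, norm_mul, norm_cexp_neg_mul, norm_mul, Complex.norm_real,
      Real.norm_of_nonneg (Real.exp_pos _).le]
    gcongr
  · refine Eventually.of_forall fun x ζ _ => ?_
    have h1 : HasDerivAt (fun ζ : ℂ => -ζ * x) (-x : ℂ) ζ := by
      simpa using (hasDerivAt_id ζ).neg.mul_const (x : ℂ)
    convert! h1.cexp.mul_const (w x : ℂ) using 1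
    push_cast
    ring

lemma halfLineLaplace_ofReal (w : ℝ → ℝ) (l : ℝ) :
    halfLineLaplace w l = ((∫ x in Ioi (0:ℝ), Real.exp (-l * x) * w x : ℝ) : ℂ) := by
  rw [halfLineLaplace, ← integral_complex_ofReal]
  simp

lemma analyticOnNhd_halfLineLaplace {w : ℝ → ℝ} (hwm : Measurable w)
    (hw : ∀ l : ℝ, 0 < l → IntegrableOn (fun x => Real.exp (-l * x) * w x) (Ioi 0)) :
    AnalyticOnNhd ℂ (halfLineLaplace w) {z | 0 < z.re} :=
  DifferentiableOn.analyticOnNhd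
    (fun _ hz => (hasDerivAt_halfLineLaplace hwm hw hz).differentiableAt.differentiableWithinAt)
    (isOpen_lt continuous_const Complex.continuous_re)

/-- An identity between Laplace transforms on the positive reals extends to the half-plane. -/
lemma halfLineLaplace_eq_mul {w k p : ℝ → ℝ} (hwm : Measurable w)
    (hw : ∀ l : ℝ, 0 < l → IntegrableOn (fun x => Real.exp (-l * x) * w x) (Ioi 0))
    (hkm : Measurable k)
    (hk : ∀ l : ℝ, 0 < l → IntegrableOn (fun x => Real.exp (-l * x) * k x) (Ioi 0))
    (hpm : Measurable p)
    (hp : ∀ l : ℝ, 0 < l → IntegrableOn (fun x => Real.exp (-l * x) * p x) (Ioi 0))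
    (h : ∀ l : ℝ, 0 < l → ∫ x in Ioi (0:ℝ), Real.exp (-l * x) * w x =
      (∫ x in Ioi (0:ℝ), Real.exp (-l * x) * k x) * ∫ x in Ioi (0:ℝ), Real.exp (-l * x) * p x)
    {z : ℂ} (hz : 0 < z.re) :
    halfLineLaplace w z = halfLineLaplace k z * halfLineLaplace p z := by
  have hconv : IsPreconnected {z : ℂ | 0 < z.re} :=
    (convex_halfSpace_re_gt 0).isPreconnected
  refine (analyticOnNhd_halfLineLaplace hwm hw).eqOn_of_preconnected_of_frequently_eq
    ((analyticOnNhd_halfLineLaplace hkm hk).mul (analyticOnNhd_halfLineLaplace hpm hp)) hconv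
    (z₀ := (1 : ℂ)) (by simp) ?_ hz
  have htend : Tendsto (fun l : ℝ => (l : ℂ)) (𝓝[≠] 1) (𝓝[≠] 1) := by
    refine tendsto_nhdsWithin_iff.2 ⟨?_, ?_⟩
    · exact (Complex.continuous_ofReal.tendsto' 1 1 (by simp)).mono_left nhdsWithin_le_nhds
    · filter_upwards [self_mem_nhdsWithin] with l hl
      simpa using hl
  refine htend.frequently (Eventually.frequently ?_)
  filter_upwards [nhdsWithin_le_nhds (Ioi_mem_nhds one_pos)] with l hl
  rw [halfLineLaplace_ofReal, halfLineLaplace_ofReal, halfLineLaplace_ofReal, h l hl]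
  push_cast
  rfl

lemma im_halfLineLaplace {w : ℝ → ℝ} (hwm : Measurable w)
    (hw : ∀ l : ℝ, 0 < l → IntegrableOn (fun x => Real.exp (-l * x) * w x) (Ioi 0)) (t : ℝ) :
    (halfLineLaplace w (1 - Complex.I * t)).im =
      ∫ x in Ioi (0:ℝ), Real.sin (t * x) * (Real.exp (-x) * w x) := by
  have hz : 0 < (1 - Complex.I * t : ℂ).re := by simp
  have h := integral_im (𝕜 := ℂ) (integrableOn_cexp_mul hwm hw hz)
  rw [halfLineLaplace]
  refine h.symm.trans (integral_congr_ae (Eventually.of_forall fun x => ?_))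
  simp [Complex.exp_im]
  ring

lemma abs_one_sub_cos_le (y : ℝ) : |1 - Real.cos y| ≤ |y| := by
  have := Real.abs_sin_le_abs (x := y / 2)
  have h1 : 1 - Real.cos y = 2 * Real.sin (y / 2) ^ 2 := by
    have := Real.cos_sq (y / 2)
    rw [Real.sin_sq, this]
    ring_nf
  have h2 : |Real.sin (y / 2)| ≤ 1 := Real.abs_sin_le_one _
  rw [h1, abs_mul, abs_two, abs_pow]
  rw [abs_div, abs_two] at this
  nlinarith [abs_nonneg (Real.sin (y / 2))]

lemma integrableOn_one_sub_cos_mul {w : ℝ → ℝ} (hwm : Measurable w)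
    (hw : IntegrableOn (fun x => Real.exp (-x) * w x) (Ioi 0)) (t : ℝ) :
    IntegrableOn (fun x => (1 - Real.cos (t * x)) * (Real.exp (-x) * w x / x)) (Ioi 0) := by
  refine (hw.norm.const_mul |t|).mono' (by fun_prop) ?_
  filter_upwards [ae_restrict_mem measurableSet_Ioi] with x hx
  have hx : 0 < x := hx
  rw [norm_mul, norm_div, Real.norm_eq_abs, Real.norm_of_nonneg hx.le]
  have h := abs_one_sub_cos_le (t * x)
  rw [abs_mul, abs_of_pos hx] at h
  calc _ ≤ |t| * x * (‖Real.exp (-x) * w x‖ / x) := by gcongr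
    _ = _ := by field_simp

lemma hasDerivAt_integral_one_sub_cos {w : ℝ → ℝ} (hwm : Measurable w)
    (hw : ∀ l : ℝ, 0 < l → IntegrableOn (fun x => Real.exp (-l * x) * w x) (Ioi 0)) (t : ℝ) :
    HasDerivAt (fun t => ∫ x in Ioi (0:ℝ), (1 - Real.cos (t * x)) * (Real.exp (-x) * w x / x))
      (halfLineLaplace w (1 - Complex.I * t)).im t := by
  have hw1 : IntegrableOn (fun x => Real.exp (-x) * w x) (Ioi 0) := by
    simpa using hw 1 one_pos
  rw [im_halfLineLaplace hwm hw]
  refine (hasDerivAt_integral_of_dominated_loc_of_deriv_le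
    (μ := volume.restrict (Ioi (0:ℝ)))
    (F := fun (t : ℝ) (x : ℝ) => (1 - Real.cos (t * x)) * (Real.exp (-x) * w x / x))
    (F' := fun (t : ℝ) (x : ℝ) => Real.sin (t * x) * (Real.exp (-x) * w x))
    (bound := fun x => ‖Real.exp (-x) * w x‖) univ_mem
    (Eventually.of_forall fun ζ => by fun_prop) (integrableOn_one_sub_cos_mul hwm hw1 t)
    (by fun_prop) ?_ hw1.norm ?_).2
  · refine Eventually.of_forall fun x t _ => ?_
    rw [norm_mul]
    exact mul_le_of_le_one_left (norm_nonneg _) (Real.abs_sin_le_one _)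
  · filter_upwards [ae_restrict_mem measurableSet_Ioi] with x hx t _
    have hx : 0 < x := hx
    have h1 : HasDerivAt (fun t : ℝ => t * x) x t := by
      simpa using (hasDerivAt_id t).mul_const x
    convert! (h1.cos.const_sub 1).mul_const (Real.exp (-x) * w x / x) using 1
    field_simp

lemma integral_one_sub_cos_mul_exp (t : ℝ) :
    ∫ x in Ioi (0:ℝ), (1 - Real.cos (t * x)) * (Real.exp (-x) * 1 / x) =
      Real.log (1 + t ^ 2) / 2 := by
  have hw : ∀ l : ℝ, 0 < l → IntegrableOn (fun x => Real.exp (-l * x) * 1) (Ioi 0) := by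
    intro l hl
    simpa using exp_neg_integrableOn_Ioi 0 hl
  have hd : ∀ t : ℝ, HasDerivAt
      (fun t => (∫ x in Ioi (0:ℝ), (1 - Real.cos (t * x)) * (Real.exp (-x) * 1 / x)) -
        Real.log (1 + t ^ 2) / 2) 0 t := by
    intro t
    have hpos : 0 < 1 + t ^ 2 := by positivity
    have h1 := hasDerivAt_integral_one_sub_cos (w := fun _ => 1) measurable_const hw t
    have h2 : HasDerivAt (fun t : ℝ => Real.log (1 + t ^ 2) / 2) (t / (1 + t ^ 2)) t := by
      convert! ((((hasDerivAt_id t).pow 2).const_add 1).log hpos.ne').div_const 2 using 1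
      simp
      field_simp
    have h3 : (halfLineLaplace (fun _ => 1) (1 - Complex.I * t)).im = t / (1 + t ^ 2) := by
      have : halfLineLaplace (fun _ => 1) (1 - Complex.I * t) = 1 / (1 - Complex.I * t) := by
        have h := integral_exp_mul_complex_Ioi (a := -(1 - Complex.I * t)) (by simp) 0
        simp only [halfLineLaplace, Complex.ofReal_one, mul_one]
        rw [h, neg_div_neg_eq]
        simp
      rw [this, one_div, Complex.inv_im]
      simp [Complex.normSq_apply]
      ring
    rw [h3] at h1
    have h4 := h1.sub h2
    rw [sub_self] at h4
    exact h4
  have hconst := is_const_of_deriv_eq_zero (fun x => (hd x).differentiableAt)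
    (fun x => (hd x).deriv) t 0
  simp at hconst
  simpa using sub_eq_zero.1 hconst

lemma integral_one_sub_cos_ge {k : ℝ → ℝ} (hk : AntitoneOn k (Ioi 0)) (hkm : Measurable k)
    (hkL : ∀ l : ℝ, 0 < l → IntegrableOn (fun x => Real.exp (-l * x) * k x) (Ioi 0))
    (hknn : ∀ x, 0 < x → 0 ≤ k x) (hk0 : ∀ N, ∃ x, 0 < x ∧ N < k x) {N : ℝ} (hN : 0 ≤ N) :
    ∃ C, ∀ t : ℝ, N * (Real.log (1 + t ^ 2) / 2) - C ≤
      ∫ x in Ioi (0:ℝ), (1 - Real.cos (t * x)) * (Real.exp (-x) * k x / x) := by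
  obtain ⟨δ, hδ, -, hδk⟩ := exists_kernel_gt hk hk0 N one_pos
  refine ⟨2 * N / δ, fun t => ?_⟩
  have he : IntegrableOn (fun x : ℝ => Real.exp (-x)) (Ioi 0) := by
    simpa using exp_neg_integrableOn_Ioi 0 one_pos
  have h1 := integrableOn_one_sub_cos_mul (w := fun _ => 1) measurable_const
    (by simpa using he) t
  have h2 := integrableOn_one_sub_cos_mul hkm (by simpa using hkL 1 one_pos) t
  have h3 : ∫ x in Ioi (0:ℝ), (N * ((1 - Real.cos (t * x)) * (Real.exp (-x) * 1 / x)) -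
      2 * N / δ * Real.exp (-x)) = N * (Real.log (1 + t ^ 2) / 2) - 2 * N / δ := by
    rw [integral_sub (h1.const_mul N) (he.const_mul _), integral_const_mul, integral_const_mul,
      integral_one_sub_cos_mul_exp, integral_exp_neg_Ioi_zero, mul_one]
  rw [← h3]
  refine setIntegral_mono_on ((h1.const_mul N).sub (he.const_mul _)) h2 measurableSet_Ioi
    fun x hx => ?_
  have hx : 0 < x := hx
  have hc : 0 ≤ 1 - Real.cos (t * x) := by linarith [Real.cos_le_one (t * x)]
  have hc2 : 1 - Real.cos (t * x) ≤ 2 := by linarith [Real.neg_one_le_cos (t * x)]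
  have hex := Real.exp_pos (-x)
  rcases le_or_gt x δ with h | h
  · have hkx := hδk x ⟨hx, h⟩
    have : N * ((1 - Real.cos (t * x)) * (Real.exp (-x) * 1 / x)) ≤
        (1 - Real.cos (t * x)) * (Real.exp (-x) * k x / x) := by
      calc _ = (1 - Real.cos (t * x)) * (Real.exp (-x) * N / x) := by ring
        _ ≤ _ := by gcongr
    have : 0 ≤ 2 * N / δ * Real.exp (-x) := by positivity
    linarith
  · have h4 : 0 ≤ (1 - Real.cos (t * x)) * (Real.exp (-x) * k x / x) := by
      have := hknn x hx
      positivity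
    have h5 : N * ((1 - Real.cos (t * x)) * (Real.exp (-x) * 1 / x)) ≤
        2 * N / δ * Real.exp (-x) := by
      calc _ ≤ N * (2 * (Real.exp (-x) * 1 / δ)) := by gcongr
        _ = _ := by ring
    linarith

lemma exists_norm_halfLineLaplace_le {k p : ℝ → ℝ} (hk : AntitoneOn k (Ioi 0))
    (hkm : Measurable k)
    (hkL : ∀ l : ℝ, 0 < l → IntegrableOn (fun x => Real.exp (-l * x) * k x) (Ioi 0))
    (hknn : ∀ x, 0 < x → 0 ≤ k x) (hk0 : ∀ N, ∃ x, 0 < x ∧ N < k x)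
    (hpm : Measurable p)
    (hpL : ∀ l : ℝ, 0 < l → IntegrableOn (fun x => Real.exp (-l * x) * p x) (Ioi 0))
    (hmul : ∀ z : ℂ, 0 < z.re → halfLineLaplace (fun x => x * p x) z =
      halfLineLaplace k z * halfLineLaplace p z) :
    ∃ C, ∀ t : ℝ, ‖halfLineLaplace p (1 - Complex.I * t)‖ ≤ C * ((1 + t ^ 2) ^ 2)⁻¹ := by
  set M : ℝ → ℂ := fun t => halfLineLaplace p (1 - Complex.I * t) with hM
  set G : ℝ → ℝ := fun t =>
    ∫ x in Ioi (0:ℝ), (1 - Real.cos (t * x)) * (Real.exp (-x) * k x / x) with hG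
  have hre : ∀ t : ℝ, 0 < (1 - Complex.I * t : ℂ).re := fun t => by simp
  have hMd : ∀ t : ℝ, HasDerivAt M (Complex.I * halfLineLaplace k (1 - Complex.I * t) * M t) t := by
    intro t
    have h1 := hasDerivAt_halfLineLaplace hpm hpL (hre t)
    have h2 : HasDerivAt (fun t : ℝ => (1 - Complex.I * t : ℂ)) (-Complex.I) t := by
      simpa using ((hasDerivAt_id t).ofReal_comp.const_mul Complex.I).const_sub 1
    convert! h1.comp t h2 using 1
    rw [hmul _ (hre t)]
    ring
  have hGd : ∀ t : ℝ, HasDerivAt G (halfLineLaplace k (1 - Complex.I * t)).im t :=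
    hasDerivAt_integral_one_sub_cos hkm hkL
  have hd : ∀ t, HasDerivAt (fun t => ‖M t‖ ^ 2 * Real.exp (2 * G t)) 0 t := by
    intro t
    convert! (hMd t).norm_sq.mul ((hGd t).const_mul 2).exp using 1
    rw [Complex.inner, ← Complex.normSq_eq_norm_sq, Complex.normSq_apply]
    simp
    ring
  have hconst : ∀ t, ‖M t‖ ^ 2 * Real.exp (2 * G t) = ‖M 0‖ ^ 2 * Real.exp (2 * G 0) := fun t =>
    is_const_of_deriv_eq_zero (fun x => (hd x).differentiableAt) (fun x => (hd x).deriv) t 0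
  obtain ⟨C, hC⟩ := integral_one_sub_cos_ge hk hkm hkL hknn hk0 (N := 4) (by norm_num)
  refine ⟨√(‖M 0‖ ^ 2 * Real.exp (2 * G 0) * Real.exp (2 * C)), fun t => ?_⟩
  have hpos : 0 < 1 + t ^ 2 := by positivity
  rw [← div_eq_mul_inv, le_div_iff₀ (by positivity)]
  refine Real.le_sqrt_of_sq_le ?_
  have h1 : ((1 + t ^ 2) ^ 2) ^ 2 ≤ Real.exp (2 * G t) * Real.exp (2 * C) := by
    have : ((1 + t ^ 2) ^ 2) ^ 2 = Real.exp (4 * Real.log (1 + t ^ 2)) := by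
      rw [← pow_mul, mul_comm (4:ℝ), Real.exp_mul, Real.exp_log hpos]
      norm_cast
    rw [this, ← Real.exp_add]
    refine Real.exp_le_exp.2 ?_
    linarith [hC t]
  calc (‖M t‖ * (1 + t ^ 2) ^ 2) ^ 2 = ‖M t‖ ^ 2 * ((1 + t ^ 2) ^ 2) ^ 2 := by ring
    _ ≤ ‖M t‖ ^ 2 * (Real.exp (2 * G t) * Real.exp (2 * C)) := by gcongr
    _ = _ := by rw [← mul_assoc, hconst t]

/-- The function `x ↦ e^{-x} w(x)` on the half-line, extended by zero. -/
noncomputable def dampedExtension (w : ℝ → ℝ) : ℝ → ℂ :=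
  (Ioi (0:ℝ)).indicator fun x => ((Real.exp (-x) * w x : ℝ) : ℂ)

lemma integrable_dampedExtension {w : ℝ → ℝ}
    (hw : ∀ l : ℝ, 0 < l → IntegrableOn (fun x => Real.exp (-l * x) * w x) (Ioi 0)) :
    Integrable (dampedExtension w) := by
  refine IntegrableOn.integrable_indicator ?_ measurableSet_Ioi
  have h : IntegrableOn (fun x => Real.exp (-x) * w x) (Ioi 0) := by simpa using hw 1 one_pos
  exact h.ofReal

lemma fourier_dampedExtension (w : ℝ → ℝ) (v : ℝ) :
    𝓕 (dampedExtension w) v = halfLineLaplace w (1 - Complex.I * (-2 * Real.pi * v : ℝ)) := by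
  rw [Real.fourier_real_eq_integral_exp_smul, halfLineLaplace, ← integral_indicator measurableSet_Ioi]
  refine integral_congr_ae (Eventually.of_forall fun x => ?_)
  simp only [dampedExtension, indicator]
  split_ifs with h
  · simp only [smul_eq_mul, Complex.ofReal_mul, Complex.ofReal_exp]
    rw [← mul_assoc, ← Complex.exp_add]
    congr 2
    push_cast
    ring
  · simp

lemma continuous_fourier_dampedExtension {w : ℝ → ℝ}
    (hw : ∀ l : ℝ, 0 < l → IntegrableOn (fun x => Real.exp (-l * x) * w x) (Ioi 0)) :
    Continuous (𝓕 (dampedExtension w)) := by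
  refine (Real.contDiff_fourier (N := 0) fun n hn => ?_).continuous
  have : n = 0 := by simpa using hn
  subst this
  simpa using (integrable_dampedExtension hw).norm

lemma norm_fourier_dampedExtension_le (w : ℝ → ℝ) (v : ℝ) :
    ‖𝓕 (dampedExtension w) v‖ ≤ ∫ x in Ioi (0:ℝ), ‖Real.exp (-x) * w x‖ := by
  rw [fourier_dampedExtension]
  refine (norm_integral_le_integral_norm _).trans (le_of_eq ?_)
  refine integral_congr_ae (Eventually.of_forall fun x => ?_)
  simp only [norm_mul, norm_cexp_neg_mul]
  simp

lemma integrable_norm_pow_mul_fourier {p : ℝ → ℝ}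
    (hpL : ∀ l : ℝ, 0 < l → IntegrableOn (fun x => Real.exp (-l * x) * p x) (Ioi 0))
    {C : ℝ} (hC : ∀ t : ℝ, ‖halfLineLaplace p (1 - Complex.I * t)‖ ≤ C * ((1 + t ^ 2) ^ 2)⁻¹)
    {n : ℕ} (hn : n ≤ 1) :
    Integrable fun v : ℝ => ‖v‖ ^ n * ‖𝓕 (dampedExtension p) v‖ := by
  have hcont := continuous_fourier_dampedExtension hpL
  have hC0 : 0 ≤ C := by
    have := (norm_nonneg _).trans (hC 0)
    simpa using this
  refine (integrable_inv_one_add_sq.const_mul C).mono' (by fun_prop)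
    (Eventually.of_forall fun v => ?_)
  rw [Real.norm_of_nonneg (by positivity), fourier_dampedExtension]
  have hv : ‖v‖ ^ n ≤ 1 + v ^ 2 := by
    rw [Real.norm_eq_abs]
    interval_cases n
    · nlinarith [sq_nonneg v]
    · nlinarith [sq_nonneg (|v| - 1), sq_abs v]
  have hpi : v ^ 2 ≤ (-2 * Real.pi * v) ^ 2 := by
    have : 1 ≤ (2 * Real.pi) ^ 2 := by nlinarith [Real.pi_gt_three]
    nlinarith [sq_nonneg v]
  calc ‖v‖ ^ n * ‖halfLineLaplace p (1 - Complex.I * (-2 * Real.pi * v : ℝ))‖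
      ≤ (1 + v ^ 2) * (C * ((1 + v ^ 2) ^ 2)⁻¹) := by
        gcongr
        refine (hC _).trans ?_
        gcongr
    _ = C * (1 + v ^ 2)⁻¹ := by
        have : 0 < 1 + v ^ 2 := by positivity
        field_simp

lemma integrable_fourier_dampedExtension {p : ℝ → ℝ}
    (hpL : ∀ l : ℝ, 0 < l → IntegrableOn (fun x => Real.exp (-l * x) * p x) (Ioi 0))
    {C : ℝ} (hC : ∀ t : ℝ, ‖halfLineLaplace p (1 - Complex.I * t)‖ ≤ C * ((1 + t ^ 2) ^ 2)⁻¹) :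
    Integrable (𝓕 (dampedExtension p)) := by
  rw [← integrable_norm_iff (continuous_fourier_dampedExtension hpL).aestronglyMeasurable]
  simpa using integrable_norm_pow_mul_fourier hpL hC (n := 0) zero_le_one

lemma contDiff_dampedExtension {p : ℝ → ℝ} (hpc : Continuous p)
    (hpL : ∀ l : ℝ, 0 < l → IntegrableOn (fun x => Real.exp (-l * x) * p x) (Ioi 0))
    {C : ℝ} (hC : ∀ t : ℝ, ‖halfLineLaplace p (1 - Complex.I * t)‖ ≤ C * ((1 + t ^ 2) ^ 2)⁻¹) :
    ContDiff ℝ 1 (dampedExtension p) := by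
  have hF : ContDiff ℝ 1 (𝓕⁻ (𝓕 (dampedExtension p))) := by
    have h1 : ContDiff ℝ 1 (𝓕 (𝓕 (dampedExtension p))) :=
      Real.contDiff_fourier (N := 1) fun n hn =>
        integrable_norm_pow_mul_fourier hpL hC (by exact_mod_cast hn)
    have h2 : 𝓕⁻ (𝓕 (dampedExtension p)) = fun w => 𝓕 (𝓕 (dampedExtension p)) (-w) :=
      funext fun w => Real.fourierInv_eq_fourier_neg _ w
    rw [h2]
    exact h1.comp contDiff_neg
  have hneg : ∀ x ≤ (0:ℝ), dampedExtension p x = 0 := fun x hx =>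
    indicator_of_notMem (by simpa using hx) _
  have heq : ∀ v : ℝ, v ≠ 0 → 𝓕⁻ (𝓕 (dampedExtension p)) v = dampedExtension p v := by
    intro v hv
    refine (integrable_dampedExtension hpL).fourierInv_fourier_eq
      (integrable_fourier_dampedExtension hpL hC) ?_
    rcases lt_or_gt_of_ne hv with h | h
    · refine (continuousAt_const : ContinuousAt (fun _ : ℝ => (0:ℂ)) v).congr ?_
      filter_upwards [Iio_mem_nhds h] with x hx
      exact (hneg x (le_of_lt hx)).symm
    · have h1 : Continuous fun x => ((Real.exp (-x) * p x : ℝ) : ℂ) := by fun_prop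
      refine h1.continuousAt.congr ?_
      filter_upwards [Ioi_mem_nhds h] with x hx
      exact (indicator_of_mem (f := fun x => ((Real.exp (-x) * p x : ℝ) : ℂ)) hx).symm
  have h0 : 𝓕⁻ (𝓕 (dampedExtension p)) 0 = 0 := by
    refine tendsto_nhds_unique (f := 𝓕⁻ (𝓕 (dampedExtension p))) (l := 𝓝[<] (0:ℝ))
      (hF.continuous.continuousAt.mono_left nhdsWithin_le_nhds) (tendsto_const_nhds.congr' ?_)
    filter_upwards [self_mem_nhdsWithin] with x hx
    rw [heq x (ne_of_lt hx), hneg x (le_of_lt hx)]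
  have : dampedExtension p = 𝓕⁻ (𝓕 (dampedExtension p)) := by
    ext v
    rcases eq_or_ne v 0 with rfl | hv
    · rw [h0, hneg 0 le_rfl]
    · exact (heq v hv).symm
  rw [this]
  exact hF

lemma contDiff_indicator_of_decay {p : ℝ → ℝ} (hpc : Continuous p)
    (hpL : ∀ l : ℝ, 0 < l → IntegrableOn (fun x => Real.exp (-l * x) * p x) (Ioi 0))
    {C : ℝ} (hC : ∀ t : ℝ, ‖halfLineLaplace p (1 - Complex.I * t)‖ ≤ C * ((1 + t ^ 2) ^ 2)⁻¹) :
    ContDiff ℝ 1 ((Ioi (0:ℝ)).indicator p) := by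
  have h : (Ioi (0:ℝ)).indicator p =
      fun x => Real.exp x * Complex.reCLM (dampedExtension p x) := by
    ext x
    simp only [dampedExtension, indicator]
    split_ifs with hx
    · simp only [Complex.reCLM_apply, Complex.ofReal_re]
      rw [← mul_assoc, ← Real.exp_add]
      simp
    · simp
  rw [h]
  exact Real.contDiff_exp.mul
    (Complex.reCLM.contDiff.comp (contDiff_dampedExtension hpc hpL hC))

lemma mul_indicator_eq_integral {k p : ℝ → ℝ}
    (hkL : ∀ l : ℝ, 0 < l → IntegrableOn (fun x => Real.exp (-l * x) * k x) (Ioi 0))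
    (hpc : Continuous p)
    (hpL : ∀ l : ℝ, 0 < l → IntegrableOn (fun x => Real.exp (-l * x) * p x) (Ioi 0))
    (hmul : ∀ z : ℂ, 0 < z.re → halfLineLaplace (fun x => x * p x) z =
      halfLineLaplace k z * halfLineLaplace p z)
    {C : ℝ} (hC : ∀ t : ℝ, ‖halfLineLaplace p (1 - Complex.I * t)‖ ≤ C * ((1 + t ^ 2) ^ 2)⁻¹)
    (x : ℝ) :
    x * (Ioi (0:ℝ)).indicator p x =
      ∫ t in Ioi (0:ℝ), k t * (Ioi (0:ℝ)).indicator p (x - t) := by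
  have hxL : ∀ l : ℝ, 0 < l → IntegrableOn (fun x => Real.exp (-l * x) * (x * p x)) (Ioi 0) :=
    fun l hl => integrableOn_exp_mul_id_mul hpc.measurable hpL hl
  set B := ContinuousLinearMap.mul ℂ ℂ
  have hki := integrable_dampedExtension hkL
  have hpi := integrable_dampedExtension hpL
  have hpcont := (contDiff_dampedExtension hpc hpL hC).continuous
  have hF : 𝓕 (dampedExtension fun x => x * p x) =
      𝓕 (dampedExtension k ⋆[B] dampedExtension p) := by
    ext v
    rw [Real.fourier_mul_convolution_eq hki hpi, fourier_dampedExtension,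
      fourier_dampedExtension, fourier_dampedExtension, hmul _ (by simp)]
  have hpF := integrable_fourier_dampedExtension hpL hC
  have hFi : Integrable (𝓕 (dampedExtension fun x => x * p x)) := by
    refine (hpF.norm.const_mul (∫ x in Ioi (0:ℝ), ‖Real.exp (-x) * k x‖)).mono'
      (continuous_fourier_dampedExtension hxL).aestronglyMeasurable
      (Eventually.of_forall fun v => ?_)
    rw [hF, Real.fourier_mul_convolution_eq hki hpi, norm_mul]
    gcongr
    exact norm_fourier_dampedExtension_le k v
  have hbdd : BddAbove (range fun x : ℝ => ‖dampedExtension p x‖) := by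
    refine ⟨∫ v : ℝ, ‖𝓕 (dampedExtension p) v‖, ?_⟩
    rintro _ ⟨x, rfl⟩
    dsimp only
    rw [← congrFun (hpcont.fourierInv_fourier_eq hpi hpF) x, Real.fourierInv_eq_fourier_neg]
    exact VectorFourier.norm_fourierIntegral_le_integral_norm 𝐞 volume (innerₗ ℝ) _ _
  have hxeq : (dampedExtension fun x => x * p x) = fun x : ℝ => (x : ℂ) * dampedExtension p x := by
    ext x
    simp only [dampedExtension, indicator]
    split_ifs
    · push_cast; ring
    · simp
  have hxcont : Continuous (dampedExtension fun x => x * p x) := by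
    rw [hxeq]
    fun_prop
  have hconv : (dampedExtension fun x => x * p x) = dampedExtension k ⋆[B] dampedExtension p := by
    rw [← hxcont.fourierInv_fourier_eq (integrable_dampedExtension hxL) hFi, hF]
    exact (hbdd.continuous_convolution_right_of_integrable B hki hpcont).fourierInv_fourier_eq
      (hki.integrable_convolution B hpi) (hF ▸ hFi)
  have h := congrFun hconv x
  have hre : (dampedExtension k ⋆[B] dampedExtension p) x =
      ((Real.exp (-x) * ∫ t in Ioi (0:ℝ), k t * (Ioi (0:ℝ)).indicator p (x - t) : ℝ) : ℂ) := by
    rw [convolution_def, ← integral_const_mul, ← integral_complex_ofReal,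
      ← integral_indicator measurableSet_Ioi]
    refine integral_congr_ae (Eventually.of_forall fun t => ?_)
    simp only [dampedExtension, indicator, B, ContinuousLinearMap.mul_apply']
    split_ifs
    · rw [← Complex.ofReal_mul]
      congr 1
      have : Real.exp (-x) = Real.exp (-t) * Real.exp (-(x - t)) := by
        rw [← Real.exp_add]; ring_nf
      rw [this]
      ring
    all_goals simp
  rw [hre, hxeq] at h
  have hl : (x : ℂ) * dampedExtension p x =
      ((Real.exp (-x) * (x * (Ioi (0:ℝ)).indicator p x) : ℝ) : ℂ) := by
    simp only [dampedExtension, indicator]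
    split_ifs
    · push_cast; ring
    · simp
  have h' : (x : ℂ) * dampedExtension p x = _ := h
  rw [hl] at h'
  exact mul_left_cancel₀ (Real.exp_pos (-x)).ne' (Complex.ofReal_injective h')

lemma mul_deriv_add_eq_integral {k P : ℝ → ℝ} (hkm : Measurable k)
    (hkI : ∀ T, 0 < T → IntervalIntegrable k volume 0 T)
    (hP : ContDiff ℝ 1 P) (hP0 : ∀ x ≤ 0, P x = 0)
    (h : ∀ x, x * P x = ∫ t in Ioi (0:ℝ), k t * P (x - t)) {x : ℝ} (hx : 0 < x) :
    x * deriv P x + P x = ∫ u in 0..x, deriv P u * k (x - u) := by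
  have hPd : ∀ y, HasDerivAt P (deriv P y) y := fun y =>
    (hP.differentiable one_ne_zero y).hasDerivAt
  have hqc : Continuous (deriv P) := hP.continuous_deriv le_rfl
  have hPc := hP.continuous
  have hq0 : ∀ y ≤ 0, deriv P y = 0 := by
    have h1 : ∀ y < 0, deriv P y = 0 := by
      intro y hy
      have : P =ᶠ[𝓝 y] fun _ => 0 := by
        filter_upwards [Iio_mem_nhds hy] with z hz
        exact hP0 z (le_of_lt hz)
      rw [this.deriv_eq]
      simp
    intro y hy
    rcases hy.lt_or_eq with hy | rfl
    · exact h1 y hy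
    · refine tendsto_nhds_unique (f := deriv P) (l := 𝓝[<] (0:ℝ))
        (hqc.continuousAt.mono_left nhdsWithin_le_nhds) (tendsto_const_nhds.congr' ?_)
      filter_upwards [self_mem_nhdsWithin] with z hz
      exact (h1 z hz).symm
  set T := x + 1 with hT
  have hTpos : 0 < T := by linarith
  have hrestrict : ∀ f : ℝ → ℝ, (∀ y ≤ 0, f y = 0) → ∀ y ≤ T,
      ∫ t in Ioi (0:ℝ), k t * f (y - t) = ∫ t in Ioc 0 T, k t * f (y - t) := by
    intro f hf y hy
    refine (setIntegral_eq_of_subset_of_forall_sdiff_eq_zero measurableSet_Ioi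
      Ioc_subset_Ioi_self fun t ht => ?_)
    have : T < t := by
      by_contra! hc
      exact ht.2 ⟨ht.1, hc⟩
    rw [hf _ (by linarith), mul_zero]
  have hkT : IntegrableOn k (Ioc 0 T) :=
    (intervalIntegrable_iff_integrableOn_Ioc_of_le hTpos.le).1 (hkI T hTpos)
  obtain ⟨M, hM⟩ := (isCompact_Icc (a := -T) (b := T)).exists_bound_of_continuousOn
    hqc.continuousOn
  have hkP : IntegrableOn (fun t => k t * P (x - t)) (Ioc 0 T) := by
    have h2 : ContinuousOn (fun t => P (x - t)) (Icc 0 T) := by fun_prop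
    have h3 : IntegrableOn k (Icc 0 T) := (integrableOn_Icc_iff_integrableOn_Ioc (by simp)).2 hkT
    exact (h3.mul_continuousOn h2 isCompact_Icc).mono_set Ioc_subset_Icc_self
  have hder : HasDerivAt (fun y => ∫ t in Ioc 0 T, k t * P (y - t))
      (∫ t in Ioc 0 T, k t * deriv P (x - t)) x := by
    refine (hasDerivAt_integral_of_dominated_loc_of_deriv_le
      (μ := volume.restrict (Ioc 0 T))
      (F := fun y t => k t * P (y - t)) (F' := fun y t => k t * deriv P (y - t))
      (bound := fun t => ‖k t‖ * M) (Ioo_mem_nhds hx (by linarith : x < T))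
      (Eventually.of_forall fun y => by fun_prop) hkP (by fun_prop) ?_ (hkT.norm.mul_const M) ?_).2
    · filter_upwards [ae_restrict_mem measurableSet_Ioc] with t ht y hy
      rw [norm_mul]
      gcongr
      exact hM _ ⟨by linarith [hy.1, ht.2], by linarith [hy.2, ht.1]⟩
    · refine Eventually.of_forall fun t y _ => ?_
      have := (hPd (y - t)).comp_sub_const y t
      exact this.const_mul (k t)
  have hlhs : HasDerivAt (fun y => y * P y) (1 * P x + x * deriv P x) x :=
    (hasDerivAt_id x).mul (hPd x)
  have heq : (fun y => ∫ t in Ioc 0 T, k t * P (y - t)) =ᶠ[𝓝 x] fun y => y * P y := by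
    filter_upwards [Iio_mem_nhds (by linarith : x < T)] with y hy
    rw [h y, hrestrict P hP0 y (le_of_lt hy)]
  have h4 := hlhs.unique (hder.congr_of_eventuallyEq heq.symm)
  have h5 : ∫ t in Ioc 0 T, k t * deriv P (x - t) = ∫ t in Ioc 0 x, k t * deriv P (x - t) := by
    refine (setIntegral_eq_of_subset_of_forall_sdiff_eq_zero measurableSet_Ioc
      (Ioc_subset_Ioc_right (by linarith)) fun t ht => ?_)
    have : x < t := by
      by_contra! hc
      exact ht.2 ⟨ht.1.1, hc⟩
    rw [hq0 _ (by linarith), mul_zero]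
  have h6 := intervalIntegral.integral_comp_sub_left (a := 0) (b := x)
    (fun t => k t * deriv P (x - t)) x
  simp only [sub_sub_cancel, sub_self, sub_zero] at h6
  rw [add_comm, ← one_mul (P x), h4, h5, ← intervalIntegral.integral_of_le hx.le, ← h6]
  simp only [mul_comm]

/-- A continuous probability density on the half-line whose Laplace transform satisfies
`-𝓛p' = 𝓛k · 𝓛p` for a non-increasing unbounded kernel `k` is strictly unimodal, with mode to the
right of `{k > 1}`. -/
lemma exists_mode_of_laplace_equation {k p : ℝ → ℝ} (hk : AntitoneOn k (Ioi 0))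
    (hkm : Measurable k) (hkI : ∀ T, 0 < T → IntervalIntegrable k volume 0 T)
    (hkL : ∀ l : ℝ, 0 < l → IntegrableOn (fun x => Real.exp (-l * x) * k x) (Ioi 0))
    (hknn : ∀ x, 0 < x → 0 ≤ k x) (hk0 : ∀ N, ∃ x, 0 < x ∧ N < k x)
    (hpc : Continuous p) (hpnn : ∀ x, 0 ≤ p x) (hpi : IntegrableOn p (Ioi 0))
    (hpL : ∀ l : ℝ, 0 < l → IntegrableOn (fun x => Real.exp (-l * x) * p x) (Ioi 0))
    (hppos : ∀ ε, 0 < ε → ∃ x ∈ Ioo 0 ε, 0 < p x)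
    (hmul : ∀ l : ℝ, 0 < l → ∫ x in Ioi (0:ℝ), Real.exp (-l * x) * (x * p x) =
      (∫ x in Ioi (0:ℝ), Real.exp (-l * x) * k x) * ∫ x in Ioi (0:ℝ), Real.exp (-l * x) * p x) :
    ∃ a, 0 < a ∧ StrictMonoOn p (Icc 0 a) ∧ StrictAntiOn p (Ici a) ∧
      ∀ x, 0 < x → 1 < k x → x ≤ a := by
  have hmulC : ∀ z : ℂ, 0 < z.re → halfLineLaplace (fun x => x * p x) z =
      halfLineLaplace k z * halfLineLaplace p z := fun z hz =>
    halfLineLaplace_eq_mul (by fun_prop)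
      (fun l hl => integrableOn_exp_mul_id_mul hpc.measurable hpL hl) hkm hkL hpc.measurable hpL
      hmul hz
  obtain ⟨C, hC⟩ := exists_norm_halfLineLaplace_le hk hkm hkL hknn hk0 hpc.measurable hpL hmulC
  have hPC := contDiff_indicator_of_decay hpc hpL hC
  have hE := mul_indicator_eq_integral hkL hpc hpL hmulC hC
  set P := (Ioi (0:ℝ)).indicator p with hP
  have hP0 : ∀ x ≤ 0, P x = 0 := fun x hx => indicator_of_notMem (by simpa using hx) _
  have hPp : ∀ x, 0 < x → P x = p x := fun x hx => indicator_of_mem (s := Ioi (0:ℝ)) hx _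
  have hPp' : ∀ x, 0 ≤ x → P x = p x := by
    intro x hx
    rcases hx.lt_or_eq with hx | rfl
    · exact hPp x hx
    · refine tendsto_nhds_unique (f := P) (l := 𝓝[>] (0:ℝ))
        (hPC.continuous.continuousAt.mono_left nhdsWithin_le_nhds)
        ((hpc.continuousAt.mono_left nhdsWithin_le_nhds).congr' ?_)
      filter_upwards [self_mem_nhdsWithin] with z hz
      exact (hPp z hz).symm
  have hPnn : ∀ x, 0 ≤ P x := fun x => indicator_nonneg (fun y _ => hpnn y) x
  have hPmono : ¬ StrictMonoOn P (Ici 0) := by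
    intro hmono
    have h1 : 0 < P 1 := by
      rw [← hP0 0 le_rfl]
      exact hmono (mem_Ici.2 le_rfl) (mem_Ici.2 zero_le_one) one_pos
    have h2 : IntegrableOn (fun _ : ℝ => P 1) (Ioi 1) := by
      refine (hpi.mono_set (Ioi_subset_Ioi zero_le_one)).mono' (by fun_prop) ?_
      filter_upwards [ae_restrict_mem measurableSet_Ioi] with x hx
      have hx : 1 < x := hx
      rw [Real.norm_of_nonneg h1.le, ← hPp x (by linarith)]
      exact (hmono (mem_Ici.2 zero_le_one) (mem_Ici.2 (by linarith)) hx).le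
    have h3 := integrableOn_const_iff (μ := volume) (s := Ioi (1:ℝ)) (C := P 1) |>.1 h2
    simp [h1.ne'] at h3
  obtain ⟨a, ha, hmono, hanti, hka⟩ := exists_mode_of_kernel_equation (P := P) (q := deriv P)
    hk hkm hkI hk0 (fun x => (hPC.differentiable one_ne_zero x).hasDerivAt)
    (hPC.continuous_deriv le_rfl) (hP0 0 le_rfl) hPnn
    (fun ε hε => by
      obtain ⟨x, hx, hpx⟩ := hppos ε hε
      exact ⟨x, hx, (hPp x hx.1).symm ▸ hpx⟩) hPmono
    (fun x hx => mul_deriv_add_eq_integral hkm hkI hPC hP0 hE hx)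
  exact ⟨a, ha, hmono.congr fun x hx => hPp' x hx.1,
    hanti.congr fun x hx => hPp' x (ha.le.trans hx), hka⟩

lemma eq_withDensity_restrict {m : Measure ℝ} {S : Set ℝ} {f : ℝ → ℝ}
    (h : ∀ A : Set ℝ, MeasurableSet A → m A = ∫⁻ x in A ∩ S, ENNReal.ofReal (f x)) :
    m = (volume.restrict S).withDensity fun x => ENNReal.ofReal (f x) := by
  ext A hA
  rw [h A hA, withDensity_apply _ hA, Measure.restrict_restrict hA]

lemma integral_eq_of_density {m : Measure ℝ} {S : Set ℝ} {f : ℝ → ℝ}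
    (hf : Measurable f) (hf0 : ∀ x, 0 ≤ f x)
    (h : ∀ A : Set ℝ, MeasurableSet A → m A = ∫⁻ x in A ∩ S, ENNReal.ofReal (f x))
    (g : ℝ → ℝ) : ∫ x, g x ∂m = ∫ x in S, g x * f x := by
  rw [eq_withDensity_restrict h,
    integral_withDensity_eq_integral_toReal_smul (by fun_prop) (by simp)]
  refine integral_congr_ae (Eventually.of_forall fun x => ?_)
  simp [ENNReal.toReal_ofReal (hf0 x), mul_comm]

lemma exists_forall_ge_lt_rpow {β : ℝ} (hβ : 0 < β) (N : ℝ) :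
    ∃ K : ℝ, 1 ≤ K ∧ ∀ κ, K ≤ κ → N < κ ^ β := by
  obtain ⟨K, hK⟩ := eventually_atTop.1 ((tendsto_rpow_atTop hβ).eventually_gt_atTop N)
  exact ⟨max 1 K, le_max_left _ _, fun κ hκ => hK κ ((le_max_right _ _).trans hκ)⟩

lemma one_sub_exp_neg_le_min {l x : ℝ} (hl : 0 < l) (hx : 0 < x) :
    1 - Real.exp (-l * x) ≤ (1 + l) * min 1 x := by
  have h1 := Real.add_one_le_exp (-l * x)
  have h2 := Real.exp_pos (-l * x)
  rcases le_total 1 x with h | h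
  · rw [min_eq_left h]; linarith
  · rw [min_eq_right h]; linarith

lemma exp_neg_mul_le_min {l x : ℝ} (hl : 0 < l) (hx : 0 < x) :
    Real.exp (-l * x) * x ≤ (1 + l⁻¹) * min 1 x := by
  have h2 : Real.exp (-l * x) ≤ 1 := Real.exp_le_one_iff.2 (by nlinarith)
  have h4 : 0 < l⁻¹ := by positivity
  rcases le_total 1 x with h | h
  · rw [min_eq_left h]
    have h1 := Real.add_one_le_exp (l * x)
    have h3 : Real.exp (-l * x) * Real.exp (l * x) = 1 := by rw [← Real.exp_add]; simp
    have h5 : Real.exp (-l * x) * (l * x) ≤ 1 := by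
      nlinarith [Real.exp_pos (-l * x)]
    have h6 : Real.exp (-l * x) * x ≤ l⁻¹ := by
      rw [← mul_le_mul_iff_right₀ hl, mul_inv_cancel₀ hl.ne']
      linarith
    linarith
  · rw [min_eq_right h]
    nlinarith

section LevyDensity

variable {w : ℝ → ℝ}

lemma integrableOn_of_le_min (hw0 : ∀ t, 0 ≤ w t) (hwm : Measurable w)
    (hw : IntegrableOn (fun x => min 1 x * w x) (Ioi 0)) {S : Set ℝ} (hS : MeasurableSet S)
    (hS0 : S ⊆ Ioi 0) {g : ℝ → ℝ} (hg : Measurable g) (C : ℝ)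
    (hgC : ∀ x ∈ S, |g x| ≤ C * min 1 x) : IntegrableOn (fun x => g x * w x) S := by
  refine ((hw.mono_set hS0).const_mul C).mono' (by fun_prop) ?_
  filter_upwards [ae_restrict_mem hS] with x hx
  rw [norm_mul, Real.norm_eq_abs, Real.norm_of_nonneg (hw0 x), ← mul_assoc]
  exact mul_le_mul_of_nonneg_right (hgC x hx) (hw0 x)

lemma integrableOn_one_sub_exp_mul (hw0 : ∀ t, 0 ≤ w t) (hwm : Measurable w)
    (hw : IntegrableOn (fun x => min 1 x * w x) (Ioi 0)) {l : ℝ} (hl : 0 < l) :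
    IntegrableOn (fun x => (1 - Real.exp (-l * x)) * w x) (Ioi 0) := by
  refine integrableOn_of_le_min hw0 hwm hw measurableSet_Ioi subset_rfl (by fun_prop) (1 + l)
    fun x hx => ?_
  have hx : 0 < x := hx
  rw [abs_of_nonneg]
  · exact one_sub_exp_neg_le_min hl hx
  · have : Real.exp (-l * x) ≤ 1 := Real.exp_le_one_iff.2 (by nlinarith)
    linarith

lemma integrableOn_exp_mul_kernel (hw0 : ∀ t, 0 ≤ w t) (hwm : Measurable w)
    (hw : IntegrableOn (fun x => min 1 x * w x) (Ioi 0)) {l : ℝ} (hl : 0 < l) :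
    IntegrableOn (fun x => Real.exp (-l * x) * (x * w x)) (Ioi 0) := by
  have := integrableOn_of_le_min (g := fun x => Real.exp (-l * x) * x) hw0 hwm hw
    measurableSet_Ioi subset_rfl (by fun_prop) (1 + l⁻¹) fun x hx => by
      have hx : 0 < x := hx
      rw [abs_of_nonneg (by positivity)]
      exact exp_neg_mul_le_min hl hx
  simpa only [mul_assoc] using this

lemma intervalIntegrable_kernel (hw0 : ∀ t, 0 ≤ w t) (hwm : Measurable w)
    (hw : IntegrableOn (fun x => min 1 x * w x) (Ioi 0)) {T : ℝ} (hT : 0 < T) :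
    IntervalIntegrable (fun x => x * w x) volume 0 T := by
  rw [intervalIntegrable_iff_integrableOn_Ioc_of_le hT.le]
  refine integrableOn_of_le_min hw0 hwm hw measurableSet_Ioc Ioc_subset_Ioi_self (by fun_prop)
    (1 + T) fun x hx => ?_
  rw [abs_of_pos hx.1]
  rcases le_total 1 x with h | h
  · rw [min_eq_left h]; linarith [hx.2]
  · rw [min_eq_right h]; nlinarith [hx.1]

lemma hasDerivAt_integral_one_sub_exp (hw0 : ∀ t, 0 ≤ w t) (hwm : Measurable w)
    (hw : IntegrableOn (fun x => min 1 x * w x) (Ioi 0)) {l : ℝ} (hl : 0 < l) :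
    HasDerivAt (fun l => ∫ x in Ioi (0:ℝ), (1 - Real.exp (-l * x)) * w x)
      (∫ x in Ioi (0:ℝ), Real.exp (-l * x) * (x * w x)) l := by
  refine (hasDerivAt_integral_of_dominated_loc_of_deriv_le
    (μ := volume.restrict (Ioi (0:ℝ)))
    (F := fun (l : ℝ) (x : ℝ) => (1 - Real.exp (-l * x)) * w x)
    (F' := fun (l : ℝ) (x : ℝ) => Real.exp (-l * x) * (x * w x))
    (bound := fun x => Real.exp (-(l / 2) * x) * (x * w x)) (Ioi_mem_nhds (half_lt_self hl))
    (Eventually.of_forall fun l => by fun_prop) (integrableOn_one_sub_exp_mul hw0 hwm hw hl)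
    (by fun_prop) ?_ (integrableOn_exp_mul_kernel hw0 hwm hw (half_pos hl)) ?_).2
  · filter_upwards [ae_restrict_mem measurableSet_Ioi] with x hx y hy
    have hx : 0 < x := hx
    have hy : l / 2 < y := hy
    have := hw0 x
    rw [Real.norm_of_nonneg (by positivity)]
    gcongr
  · refine Eventually.of_forall fun x y _ => ?_
    have h1 : HasDerivAt (fun y : ℝ => -y * x) (-x) y := by
      simpa using (hasDerivAt_id y).neg.mul_const x
    convert! (h1.exp.const_sub 1).mul_const (w x) using 1
    ring

/-- For a non-increasing kernel `t ↦ t w(t)`, the weak scaling of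
`φ(l) = ∫ (1 - e^{-lx}) w(x) dx` bounds the kernel below by `φ`. -/
lemma exists_mul_le_kernel (hw0 : ∀ t, 0 ≤ w t) (hwm : Measurable w)
    (hw : IntegrableOn (fun x => min 1 x * w x) (Ioi 0))
    (hk : AntitoneOn (fun t => t * w t) (Ioi (0:ℝ)))
    {φ : ℝ → ℝ} (hφ : ∀ l, 0 < l → φ l = ∫ x in Ioi (0:ℝ), (1 - Real.exp (-l * x)) * w x)
    (hφpos : ∀ l, 0 < l → 0 < φ l) {β₁ β₂ c₁ c₂ : ℝ} (hβ₁ : 0 < β₁) (hβ₂ : β₂ < 1)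
    (hc₁ : 0 < c₁)
    (hlo : ∀ l, 0 < l → ∀ κ, 1 ≤ κ → c₁ * κ ^ β₁ * φ l ≤ φ (κ * l))
    (hup : ∀ l, 0 < l → ∀ κ, 1 ≤ κ → φ (κ * l) ≤ c₂ * κ ^ β₂ * φ l) :
    ∃ δ c, 0 < δ ∧ 0 < c ∧ ∀ l, 0 < l → c * φ l ≤ δ / l * w (δ / l) := by
  obtain ⟨κ, hκ1, hκ⟩ := exists_forall_ge_lt_rpow hβ₁ (2 / c₁)
  have hκ2 : 2 ≤ c₁ * κ ^ β₁ := by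
    have := (hκ κ le_rfl).le
    rwa [div_le_iff₀ hc₁, mul_comm] at this
  have hκ0 : 0 < κ := by linarith
  obtain ⟨D, hD1, hD⟩ := exists_forall_ge_lt_rpow (sub_pos.2 hβ₂) (4 * κ * c₂)
  have hD0 : 0 < D := by linarith
  have hDD : 4 * κ * c₂ * D ^ β₂ ≤ D := by
    have h1 := (hD D le_rfl).le
    have h2 : D ^ (1 - β₂) * D ^ β₂ = D := by
      rw [← Real.rpow_add hD0]; simp
    calc _ ≤ D ^ (1 - β₂) * D ^ β₂ := by gcongr
      _ = D := h2
  refine ⟨D⁻¹, D⁻¹ / 2, by positivity, by positivity, fun l hl => ?_⟩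
  set s := D⁻¹ / l with hs
  have hs0 : 0 < s := by positivity
  have hDl : 0 < D * l := by positivity
  have hs' : D * l * s = 1 := by rw [hs]; field_simp
  have hexp : IntegrableOn (fun x => Real.exp (-l * x)) (Ioi 0) := by
    simpa using exp_neg_integrableOn_Ioi 0 hl
  have hi1 := integrableOn_one_sub_exp_mul hw0 hwm hw (mul_pos hκ0 hl)
  have hi2 := integrableOn_one_sub_exp_mul hw0 hwm hw hl
  have hi3 := integrableOn_one_sub_exp_mul hw0 hwm hw hDl
  have hint : φ (κ * l) - φ l ≤ 2 * κ * D⁻¹ * φ (D * l) + s * w s * (D * l) * l⁻¹ := by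
    rw [hφ _ (mul_pos hκ0 hl), hφ _ hl, hφ _ hDl, ← integral_sub hi1 hi2]
    have hexpv : l⁻¹ = ∫ x in Ioi (0:ℝ), Real.exp (-l * x) := by
      rw [integral_exp_mul_Ioi (by linarith) 0]
      simp
    rw [hexpv, ← integral_const_mul, ← integral_const_mul,
      ← integral_add (hi3.const_mul _) (hexp.const_mul _)]
    refine setIntegral_mono_on (hi1.sub hi2) ((hi3.const_mul _).add (hexp.const_mul _))
      measurableSet_Ioi fun x hx => ?_
    have hx : 0 < x := hx
    have hwx := hw0 x
    have hws := hw0 s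
    have he1 : Real.exp (-(D * l) * x) ≤ 1 := Real.exp_le_one_iff.2 (by nlinarith [mul_pos hDl hx])
    have he2 : Real.exp (-l * x) ≤ 1 := Real.exp_le_one_iff.2 (by nlinarith)
    rcases le_total x s with h | h
    · have hy0 : 0 ≤ D * l * x := by positivity
      have hy1 : D * l * x ≤ 1 := by rw [← hs']; gcongr
      have hy2 : D * l * x ≤ 2 * (1 - Real.exp (-(D * l) * x)) := by
        have h1 := Real.add_one_le_exp (D * l * x)
        have h2 : Real.exp (-(D * l) * x) * Real.exp (D * l * x) = 1 := by
          rw [← Real.exp_add]; simp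
        have h3 := Real.exp_pos (-(D * l) * x)
        nlinarith
      have h1 : Real.exp (-l * x) - Real.exp (-(κ * l) * x) ≤
          2 * κ * D⁻¹ * (1 - Real.exp (-(D * l) * x)) := by
        have h2 := Real.add_one_le_exp (-(κ * l) * x)
        have h3 : κ * D⁻¹ * (D * l * x) = κ * l * x := by field_simp
        have h4 : κ * D⁻¹ * (D * l * x) ≤
            κ * D⁻¹ * (2 * (1 - Real.exp (-(D * l) * x))) := by gcongr
        linarith
      have h2 : 0 ≤ s * w s * (D * l) * Real.exp (-l * x) := by positivity
      nlinarith [mul_le_mul_of_nonneg_right h1 hwx]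
    · have h1 : x * w x ≤ s * w s := hk (mem_Ioi.2 hs0) (mem_Ioi.2 hx) h
      have h2 : w x ≤ s * w s * (D * l) := by
        have h3 : 1 ≤ D * l * x := by rw [← hs']; gcongr
        have h4 : w x * 1 ≤ w x * (D * l * x) := by gcongr
        nlinarith
      have h3 : 0 ≤ 2 * κ * D⁻¹ * ((1 - Real.exp (-(D * l) * x)) * w x) := by
        have : 0 ≤ 1 - Real.exp (-(D * l) * x) := by linarith
        positivity
      have h4 := mul_le_mul_of_nonneg_right h2 (Real.exp_pos (-l * x)).le
      have h5 := mul_nonneg (Real.exp_pos (-(κ * l) * x)).le hwx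
      nlinarith
  have h1 : 2 * φ l ≤ φ (κ * l) := by
    refine le_trans ?_ (hlo l hl κ hκ1)
    have := (hφpos l hl).le
    gcongr
  have h2 : 2 * κ * D⁻¹ * φ (D * l) ≤ φ l / 2 := by
    have h3 := hup l hl D hD1
    have h4 := (hφpos l hl).le
    calc 2 * κ * D⁻¹ * φ (D * l) ≤ 2 * κ * D⁻¹ * (c₂ * D ^ β₂ * φ l) := by gcongr
      _ = (4 * κ * c₂ * D ^ β₂) * D⁻¹ * (φ l / 2) := by ring
      _ ≤ D * D⁻¹ * (φ l / 2) := by gcongr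
      _ = φ l / 2 := by field_simp
  have h3 : s * w s * (D * l) * l⁻¹ = s * w s * D := by field_simp
  rw [h3] at hint
  have h4 : φ l / 2 ≤ s * w s * D := by linarith
  calc D⁻¹ / 2 * φ l = D⁻¹ * (φ l / 2) := by ring
    _ ≤ D⁻¹ * (s * w s * D) := by gcongr
    _ = s * w s := by field_simp

end LevyDensity

lemma hasDerivAt_integral_exp_mul {p : ℝ → ℝ} (hpm : Measurable p)
    (hp : ∀ l : ℝ, 0 < l → IntegrableOn (fun x => Real.exp (-l * x) * p x) (Ioi 0))
    {l : ℝ} (hl : 0 < l) :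
    HasDerivAt (fun l => ∫ x in Ioi (0:ℝ), Real.exp (-l * x) * p x)
      (-∫ x in Ioi (0:ℝ), Real.exp (-l * x) * (x * p x)) l := by
  have h := (hasDerivAt_halfLineLaplace hpm hp (z := (l : ℂ)) (by simpa)).real_of_complex
  simpa only [halfLineLaplace_ofReal, ← Complex.ofReal_neg, Complex.ofReal_re] using h

lemma laplace_equation_of_exp {k p : ℝ → ℝ} (hpm : Measurable p)
    (hp : ∀ l : ℝ, 0 < l → IntegrableOn (fun x => Real.exp (-l * x) * p x) (Ioi 0))
    {φ : ℝ → ℝ} {r : ℝ}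
    (hφ : ∀ l, 0 < l → HasDerivAt φ (∫ x in Ioi (0:ℝ), Real.exp (-l * x) * k x) l)
    (hlap : ∀ l, 0 < l → ∫ x in Ioi (0:ℝ), Real.exp (-l * x) * p x = Real.exp (-r * φ l))
    {l : ℝ} (hl : 0 < l) :
    ∫ x in Ioi (0:ℝ), Real.exp (-l * x) * (x * p x) =
      (∫ x in Ioi (0:ℝ), Real.exp (-l * x) * (r * k x)) *
        ∫ x in Ioi (0:ℝ), Real.exp (-l * x) * p x := by
  have h1 := hasDerivAt_integral_exp_mul hpm hp hl
  have h2 := ((hφ l hl).const_mul (-r)).exp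
  have h3 : (fun l => ∫ x in Ioi (0:ℝ), Real.exp (-l * x) * p x) =ᶠ[𝓝 l]
      fun l => Real.exp (-r * φ l) := by
    filter_upwards [Ioi_mem_nhds hl] with y hy using hlap y hy
  have h4 := h1.unique (h2.congr_of_eventuallyEq h3)
  have h5 : ∫ x in Ioi (0:ℝ), Real.exp (-l * x) * (r * k x) =
      r * ∫ x in Ioi (0:ℝ), Real.exp (-l * x) * k x := by
    rw [← integral_const_mul]
    refine integral_congr_ae (Eventually.of_forall fun x => ?_)
    ring
  rw [hlap l hl, h5]
  linarith

lemma integrableOn_exp_mul_of_integrableOn {p : ℝ → ℝ} (hpm : Measurable p)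
    (hpi : IntegrableOn p (Ioi 0)) {l : ℝ} (hl : 0 < l) :
    IntegrableOn (fun x => Real.exp (-l * x) * p x) (Ioi 0) := by
  refine hpi.norm.mono' (by fun_prop) ?_
  filter_upwards [ae_restrict_mem measurableSet_Ioi] with x hx
  have hx : 0 < x := hx
  rw [norm_mul, Real.norm_of_nonneg (Real.exp_pos _).le]
  exact mul_le_of_le_one_left (norm_nonneg _) (Real.exp_le_one_iff.2 (by nlinarith))

lemma exists_pos_near_zero_of_laplace {p : ℝ → ℝ} (hpm : Measurable p) (hpnn : ∀ x, 0 ≤ p x)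
    (hpi : IntegrableOn p (Ioi 0)) (hp1 : ∫ x in Ioi (0:ℝ), p x = 1) {C β : ℝ} (hβ : β < 1)
    (hlap : ∀ l, 1 ≤ l → Real.exp (-(C * l ^ β)) ≤ ∫ x in Ioi (0:ℝ), Real.exp (-l * x) * p x)
    {ε : ℝ} (hε : 0 < ε) : ∃ x ∈ Ioo 0 ε, 0 < p x := by
  by_contra! h
  obtain ⟨l, hl1, hl⟩ := exists_forall_ge_lt_rpow (sub_pos.2 hβ) (C / ε)
  have hl0 : 0 < l := by linarith
  have h1 : ∫ x in Ioi (0:ℝ), Real.exp (-l * x) * p x ≤ Real.exp (-l * ε) := by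
    rw [← mul_one (Real.exp (-l * ε)), ← hp1, ← integral_const_mul]
    refine setIntegral_mono_on (integrableOn_exp_mul_of_integrableOn hpm hpi hl0)
      (hpi.const_mul _) measurableSet_Ioi fun x hx => ?_
    have hx : 0 < x := hx
    rcases lt_or_ge x ε with hxε | hxε
    · rw [le_antisymm (h x ⟨hx, hxε⟩) (hpnn x)]
      simp
    · have := hpnn x
      have h2 : -l * x ≤ -l * ε := by nlinarith
      gcongr
  have h2 := Real.exp_le_exp.1 ((hlap l hl1).trans h1)
  have h3 : C < l ^ (1 - β) * ε := (div_lt_iff₀ hε).1 (hl l le_rfl)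
  have h4 : l ^ (1 - β) * l ^ β = l := by
    rw [← Real.rpow_add hl0]; simp
  have h5 : 0 < l ^ β := Real.rpow_pos_of_pos hl0 _
  have h6 : C * l ^ β < l * ε := by
    calc C * l ^ β < l ^ (1 - β) * ε * l ^ β := by gcongr
      _ = l ^ (1 - β) * l ^ β * ε := by ring
      _ = l * ε := by rw [h4]
  linarith

lemma laplace_le_of_monotoneOn {p : ℝ → ℝ} (hpc : Continuous p) (hpnn : ∀ x, 0 ≤ p x)
    (hpi : IntegrableOn p (Ioi 0)) (hp1 : ∫ x in Ioi (0:ℝ), p x = 1) {a : ℝ} (ha : 0 < a)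
    (hmono : MonotoneOn p (Icc 0 a)) :
    ∫ x in Ioi (0:ℝ), Real.exp (-(2 / a) * x) * p x ≤ 3 / 4 := by
  have hb : 0 < a / 2 := by positivity
  have hi : ∀ s t, IntervalIntegrable p volume s t := fun s t => hpc.intervalIntegrable s t
  have h1 : ∫ x in (0:ℝ)..(a / 2), p x ≤ ∫ x in (a / 2)..a, p x := by
    have h2 : ∫ x in (a / 2)..a, p x = ∫ x in (0:ℝ)..(a / 2), p (x + a / 2) := by
      rw [intervalIntegral.integral_comp_add_right]
      simp
    rw [h2]
    refine intervalIntegral.integral_mono_on hb.le (hi _ _)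
      ((hpc.comp (by fun_prop)).intervalIntegrable _ _) fun x hx => ?_
    exact hmono ⟨hx.1, by linarith [hx.2]⟩ ⟨by linarith [hx.1], by linarith [hx.2]⟩ (by linarith)
  have h3 : (∫ x in (0:ℝ)..(a / 2), p x) + ∫ x in (a / 2)..a, p x ≤ 1 := by
    rw [intervalIntegral.integral_add_adjacent_intervals (hi _ _) (hi _ _),
      intervalIntegral.integral_of_le ha.le, ← hp1]
    exact setIntegral_mono_set hpi (Eventually.of_forall hpnn)
      (LE.le.eventuallyLE (Ioc_subset_Ioi_self : Ioc (0:ℝ) a ⊆ Ioi 0))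
  have h4 : ∫ x in (0:ℝ)..(a / 2), p x = ∫ x in Ioi (0:ℝ), (Ioc 0 (a / 2)).indicator p x := by
    rw [intervalIntegral.integral_of_le hb.le, setIntegral_indicator measurableSet_Ioc,
      inter_eq_self_of_subset_right Ioc_subset_Ioi_self]
  have hind : IntegrableOn ((Ioc 0 (a / 2)).indicator p) (Ioi 0) := hpi.indicator measurableSet_Ioc
  have he : Real.exp (-1) ≤ 1 / 2 := by
    have h5 := Real.add_one_le_exp (1:ℝ)
    have h6 : Real.exp (-1) * Real.exp 1 = 1 := by rw [← Real.exp_add]; simp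
    nlinarith [Real.exp_pos (-1)]
  calc ∫ x in Ioi (0:ℝ), Real.exp (-(2 / a) * x) * p x
      ≤ ∫ x in Ioi (0:ℝ), (1 / 2 * p x + 1 / 2 * (Ioc 0 (a / 2)).indicator p x) := by
        refine setIntegral_mono_on
          (integrableOn_exp_mul_of_integrableOn hpc.measurable hpi (by positivity))
          ((hpi.const_mul _).add (hind.const_mul _)) measurableSet_Ioi fun x hx => ?_
        have hx : 0 < x := hx
        have hpx := hpnn x
        rcases le_or_gt x (a / 2) with h | h
        · rw [indicator_of_mem (show x ∈ Ioc 0 (a / 2) from ⟨hx, h⟩)]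
          have : Real.exp (-(2 / a) * x) ≤ 1 := by
            refine Real.exp_le_one_iff.2 ?_
            have : 0 < 2 / a * x := by positivity
            linarith
          nlinarith
        · rw [indicator_of_notMem (fun hx' => h.not_ge hx'.2)]
          have h7 : 1 ≤ 2 / a * x := by
            rw [div_mul_eq_mul_div, le_div_iff₀ ha]; linarith
          have : Real.exp (-(2 / a) * x) ≤ 1 / 2 :=
            (Real.exp_le_exp.2 (by linarith)).trans he
          nlinarith
    _ ≤ 3 / 4 := by
        rw [integral_add (hpi.const_mul _) (hind.const_mul _), integral_const_mul,
          integral_const_mul, hp1, ← h4]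
        linarith

/-- Lemma 4.5(i).  Under Assumption 4.1, for each `r > 0` there exists
`a_r > 0` such that `t ↦ p̄(r,t)` is strictly increasing on `[0,a_r)` and strictly
decreasing on `(a_r,∞)`; moreover there is `c ≥ 1` with
`c⁻¹/φ⁻¹(1/r) ≤ a_r ≤ c/φ⁻¹(1/r)` for all `r > 0`. -/
theorem time_frac_stmt12
    (ν : Measure ℝ)
    (hν_loc : ∫⁻ x in Set.Ioi (0:ℝ), ENNReal.ofReal (min 1 x) ∂ν ≠ ⊤)
    (φ : ℝ → ℝ)
    (hφ : ∀ l : ℝ, 0 < l → φ l = ∫ x in Set.Ioi (0:ℝ), (1 - Real.exp (-l * x)) ∂ν)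
    -- Assumption 4.1(i): weak scaling of φ
    (β₁ β₂ c₁ c₂ : ℝ)
    (hβ : 0 < β₁ ∧ β₁ < β₂ ∧ β₂ < 1) (hc : 0 < c₁ ∧ 0 < c₂)
    (hscale : ∀ l : ℝ, 0 < l → ∀ κ : ℝ, 1 ≤ κ →
      c₁ * κ ^ β₁ ≤ φ (κ * l) / φ l ∧ φ (κ * l) / φ l ≤ c₂ * κ ^ β₂)
    -- Assumption 4.1(ii): ν has a density νd with t ↦ t·νd(t) non-increasing
    (νd : ℝ → ℝ)
    (hνd_nn : ∀ t : ℝ, 0 ≤ νd t)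
    (hνd_meas : Measurable νd)
    (hν_dens : ∀ A : Set ℝ, MeasurableSet A →
      ν A = ∫⁻ x in A ∩ Set.Ioi 0, ENNReal.ofReal (νd x))
    (hself : AntitoneOn (fun t => t * νd t) (Set.Ioi (0:ℝ)))
    -- the inverse of φ on (0,∞)
    (φinv : ℝ → ℝ)
    (hφinv : ∀ l : ℝ, 0 < l → 0 < φinv l ∧ φ (φinv l) = l)
    -- the subordinator marginals and their continuous densities
    (μr : ℝ → Measure ℝ)
    (hprob : ∀ r : ℝ, 0 < r → IsProbabilityMeasure (μr r))
    (hlap : ∀ r : ℝ, 0 < r → ∀ l : ℝ, 0 < l →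
      ∫ s, Real.exp (-l * s) ∂(μr r) = Real.exp (-r * φ l))
    (pbar : ℝ → ℝ → ℝ)
    (hpbar_nn : ∀ r t : ℝ, 0 ≤ pbar r t)
    (hpbar_cont : ∀ r : ℝ, 0 < r → Continuous (pbar r))
    (hdens : ∀ r : ℝ, 0 < r → ∀ A : Set ℝ, MeasurableSet A →
      μr r A = ∫⁻ t in A ∩ Set.Ici 0, ENNReal.ofReal (pbar r t)) :
    ∃ c : ℝ, 1 ≤ c ∧
      ∀ r : ℝ, 0 < r → ∃ a : ℝ, 0 < a ∧
        StrictMonoOn (pbar r) (Set.Ico (0:ℝ) a) ∧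
        StrictAntiOn (pbar r) (Set.Ioi a) ∧
        c⁻¹ / φinv r⁻¹ ≤ a ∧ a ≤ c / φinv r⁻¹ := by
  obtain ⟨hβ₁, -, hβ₂⟩ := hβ
  obtain ⟨hc₁, -⟩ := hc
  have hνeq := eq_withDensity_restrict hν_dens
  have hνres : ν.restrict (Ioi 0) = ν := by
    rw [hνeq, restrict_withDensity measurableSet_Ioi, Measure.restrict_restrict measurableSet_Ioi,
      inter_self]
  have hw : IntegrableOn (fun x => min 1 x * νd x) (Ioi 0) := by
    have hm : Measurable fun x : ℝ => min 1 x * νd x := by fun_prop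
    refine ⟨hm.aestronglyMeasurable, ?_⟩
    rw [hνres, hνeq, lintegral_withDensity_eq_lintegral_mul _ (by fun_prop) (by fun_prop)]
      at hν_loc
    refine lt_of_le_of_lt (le_of_eq ?_) hν_loc.lt_top
    refine setLIntegral_congr_fun measurableSet_Ioi fun x hx => ?_
    have hx : 0 < x := hx
    have h1 : 0 ≤ min 1 x := le_min zero_le_one hx.le
    rw [Pi.mul_apply, ← ENNReal.ofReal_mul (hνd_nn x), mul_comm (νd x),
      Real.enorm_of_nonneg (mul_nonneg h1 (hνd_nn x))]
  have hφ' : ∀ l, 0 < l → φ l = ∫ x in Ioi (0:ℝ), (1 - Real.exp (-l * x)) * νd x := by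
    intro l hl
    rw [hφ l hl, hνres, integral_eq_of_density hνd_meas hνd_nn hν_dens]
  have hφpos : ∀ l, 0 < l → 0 < φ l := by
    intro l hl
    refine lt_of_le_of_ne ?_ fun h => ?_
    · rw [hφ' l hl]
      refine setIntegral_nonneg measurableSet_Ioi fun x hx => mul_nonneg ?_ (hνd_nn x)
      have hx : 0 < x := hx
      have : Real.exp (-l * x) ≤ 1 := Real.exp_le_one_iff.2 (by nlinarith)
      linarith
    · have := (hscale l hl 1 le_rfl).1
      simp [← h] at this
      linarith
  have hlo : ∀ l, 0 < l → ∀ κ, 1 ≤ κ → c₁ * κ ^ β₁ * φ l ≤ φ (κ * l) := fun l hl κ hκ =>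
    (le_div_iff₀ (hφpos l hl)).1 (hscale l hl κ hκ).1
  have hup : ∀ l, 0 < l → ∀ κ, 1 ≤ κ → φ (κ * l) ≤ c₂ * κ ^ β₂ * φ l := fun l hl κ hκ =>
    (div_le_iff₀ (hφpos l hl)).1 (hscale l hl κ hκ).2
  have hφd : ∀ l, 0 < l → HasDerivAt φ (∫ x in Ioi (0:ℝ), Real.exp (-l * x) * (x * νd x)) l := by
    intro l hl
    refine (hasDerivAt_integral_one_sub_exp hνd_nn hνd_meas hw hl).congr_of_eventuallyEq ?_
    filter_upwards [Ioi_mem_nhds hl] with y hy using hφ' y hy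
  obtain ⟨δ, c, hδ, hc, hkφ⟩ := exists_mul_le_kernel hνd_nn hνd_meas hw hself hφ' hφpos hβ₁ hβ₂
    hc₁ hlo hup
  have hk0 : ∀ N, ∃ x, 0 < x ∧ N < x * νd x := by
    intro N
    have h1 := hφpos 1 one_pos
    obtain ⟨κ, hκ1, hκ⟩ := exists_forall_ge_lt_rpow hβ₁ (N / (c * c₁ * φ 1))
    have hκ0 : 0 < κ := by linarith
    refine ⟨δ / κ, by positivity, lt_of_lt_of_le ?_ (hkφ κ hκ0)⟩
    have h2 := (div_lt_iff₀ (by positivity)).1 (hκ κ le_rfl)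
    have h3 := hlo 1 one_pos κ hκ1
    rw [mul_one] at h3
    have h4 := mul_le_mul_of_nonneg_left h3 hc.le
    linarith
  obtain ⟨K, hK1, hK⟩ := exists_forall_ge_lt_rpow hβ₁ (1 / (c * c₁))
  obtain ⟨L, hL1, hL⟩ := exists_forall_ge_lt_rpow hβ₁ (4 / c₁)
  have hK0 : 0 < K := by linarith
  refine ⟨max 1 (max (K / δ) (2 * L)), le_max_left _ _, fun r hr => ?_⟩
  obtain ⟨hl, hφl⟩ := hφinv r⁻¹ (inv_pos.2 hr)
  set l := φinv r⁻¹
  have hpc := hpbar_cont r hr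
  have hpnn := hpbar_nn r
  have hprobr := hprob r hr
  set p := pbar r
  have hdr := hdens r hr
  have hpint : ∫⁻ x in Ioi (0:ℝ), ENNReal.ofReal (p x) = 1 := by
    rw [← setLIntegral_congr Ioi_ae_eq_Ici.symm, ← univ_inter (Ici (0:ℝ)), ← hdr _ .univ]
    exact measure_univ
  have hpi : IntegrableOn p (Ioi 0) := by
    refine ⟨hpc.aestronglyMeasurable, ?_⟩
    rw [hasFiniteIntegral_iff_ofReal (Eventually.of_forall hpnn), hpint]
    exact ENNReal.one_lt_top
  have hp1 : ∫ x in Ioi (0:ℝ), p x = 1 := by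
    rw [integral_eq_lintegral_of_nonneg_ae (Eventually.of_forall hpnn) hpc.aestronglyMeasurable,
      hpint, ENNReal.toReal_one]
  have hpL := fun (l : ℝ) (hl : 0 < l) =>
    integrableOn_exp_mul_of_integrableOn hpc.measurable hpi hl
  have hplap : ∀ l, 0 < l → ∫ x in Ioi (0:ℝ), Real.exp (-l * x) * p x = Real.exp (-r * φ l) := by
    intro l hl
    rw [← hlap r hr l hl, integral_eq_of_density hpc.measurable hpnn hdr,
      integral_Ici_eq_integral_Ioi]
  obtain ⟨a, ha, hmono, hanti, hka⟩ := exists_mode_of_laplace_equation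
    (k := fun x => r * (x * νd x)) (p := p)
    (fun x hx y hy hxy => mul_le_mul_of_nonneg_left (hself hx hy hxy) hr.le) (by fun_prop)
    (fun T hT => (intervalIntegrable_kernel hνd_nn hνd_meas hw hT).const_mul r)
    (fun l hl => by
      have := (integrableOn_exp_mul_kernel hνd_nn hνd_meas hw hl).const_mul r
      refine this.congr (Eventually.of_forall fun x => ?_)
      simp only
      ring)
    (fun x hx => by have := hνd_nn x; positivity)
    (fun N => by
      obtain ⟨x, hx, hNx⟩ := hk0 (N / r)
      exact ⟨x, hx, by rwa [div_lt_iff₀' hr] at hNx⟩)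
    hpc hpnn hpi hpL
    (fun ε hε => exists_pos_near_zero_of_laplace (C := r * (c₂ * φ 1)) hpc.measurable hpnn hpi hp1
      hβ₂ (fun l hl => by
        have hl0 : 0 < l := by linarith
        rw [hplap l hl0, Real.exp_le_exp]
        have h1 := hup 1 one_pos l hl
        rw [mul_one] at h1
        have h2 := mul_le_mul_of_nonneg_left h1 hr.le
        linarith) hε)
    (fun l hl => laplace_equation_of_exp hpc.measurable hpL hφd hplap hl)
  refine ⟨a, ha, hmono.mono Ico_subset_Icc_self, hanti.mono Ioi_subset_Ici_self, ?_, ?_⟩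
  · have hKl : 0 < K * l := by positivity
    have h1 : δ / (K * l) ≤ a := by
      refine hka _ (by positivity) ?_
      have h2 : 1 < c * c₁ * K ^ β₁ := by
        have := (div_lt_iff₀ (by positivity)).1 (hK K le_rfl)
        linarith
      have h3 : c * (c₁ * K ^ β₁ * φ l) ≤ δ / (K * l) * νd (δ / (K * l)) :=
        (mul_le_mul_of_nonneg_left (hlo l hl K hK1) hc.le).trans (hkφ _ hKl)
      calc 1 < c * c₁ * K ^ β₁ := h2
        _ = r * (c * (c₁ * K ^ β₁ * φ l)) := by rw [hφl]; field_simp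
        _ ≤ _ := by gcongr
    refine le_trans ?_ h1
    rw [← div_div]
    gcongr
    rw [inv_le_comm₀ (by positivity) (by positivity), inv_div]
    exact (le_max_left _ _).trans (le_max_right _ _)
  · have h1 : l * a / 2 ≤ L := by
      by_contra! hLa
      have h2 := laplace_le_of_monotoneOn hpc hpnn hpi hp1 ha hmono.monotoneOn
      have h2a : 0 < 2 / a := by positivity
      rw [hplap _ h2a] at h2
      have h3 := Real.add_one_le_exp (-r * φ (2 / a))
      have h4 := hlo (2 / a) h2a (l * a / 2) (by linarith)
      have h5 : l * a / 2 * (2 / a) = l := by field_simp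
      rw [h5, hφl] at h4
      have h6 := (div_lt_iff₀ hc₁).1 (hL _ hLa.le)
      have h7 : 1 / 4 ≤ r * φ (2 / a) := by linarith
      have h8 : r * (c₁ * (l * a / 2) ^ β₁ * φ (2 / a)) ≤ 1 := by
        calc _ ≤ r * r⁻¹ := by gcongr
          _ = 1 := mul_inv_cancel₀ hr.ne'
      nlinarith
    rw [le_div_iff₀ hl]
    calc a * l ≤ 2 * L := by linarith
      _ ≤ _ := (le_max_right _ _).trans (le_max_right _ _)
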